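/- Let G be a discrete amenable group, A a separable nuclear C*-algebra with an action α : G → Aut(A), B a C*-algebra with action β : G → Aut(B), and π : A → B a surjective G-equivariant *-homomorphism. Then for every finite set F ⊆ B, finite set M ⊆ G, and ε > 0 there exists a contractive completely positive section θ : B → A (i.e. π ∘ θ = id_B) such that ‖α_t(θ(b)) − θ(β_t(b))‖ < ε for all b ∈ F and t ∈ M. -/

import Mathlib

open scoped symmDiff

/-- The Følner condition for a discrete group `G` (equivalent to amenability). -/
def FolnerCondition (G : Type*) [Group G] [DecidableEq G] : Prop :=
  ∀ (M : Finset G) (ε : ℝ), 0 < ε → ∃ K : Finset G, K.Nonempty ∧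
    ∀ s ∈ M, ((K.image (s * ·)) ∆ K).card ≤ ε * K.card

/-- A map `θ : A → B` between *-rings is completely positive: every matrix amplification
maps positive matrices (those of the form `cᴴ c`) to positive matrices. -/
def IsCompletelyPositive {A B : Type*} [NonUnitalRing A] [StarRing A]
    [NonUnitalRing B] [StarRing B] (θ : A → B) : Prop :=
  ∀ (n : ℕ) (m : Matrix (Fin n) (Fin n) A),
    (∃ c : Matrix (Fin n) (Fin n) A, m = c.conjTranspose * c) →
    ∃ d : Matrix (Fin n) (Fin n) B, m.map θ = d.conjTranspose * d

/-- Nuclearity of a C*-algebra `A` (completely positive approximation property): the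
identity map of `A` is a point-norm limit of contractive completely positive maps
factoring through matrix algebras. -/
def IsNuclear (A : Type*) [NonUnitalCStarAlgebra A] : Prop :=
  ∀ (F : Finset A) (ε : ℝ), 0 < ε →
    ∃ (k : ℕ) (φ : A → Matrix (Fin k) (Fin k) ℂ) (ψ : Matrix (Fin k) (Fin k) ℂ → A),
      IsLinearMap ℂ φ ∧ IsLinearMap ℂ ψ ∧
      IsCompletelyPositive φ ∧ IsCompletelyPositive ψ ∧
      (∀ x : A, ‖ψ (φ x)‖ ≤ ‖x‖) ∧
      ∀ x ∈ F, ‖ψ (φ x) - x‖ < ε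

/-- A map of *-rings is completely positive on families when it sends each Gram matrix
`(star (c p) * c q)` to a finite sum of Gram matrices. -/
def IsFamilyCP {X Y : Type*} [NonUnitalRing X] [StarRing X] [NonUnitalRing Y] [StarRing Y]
    (T : X → Y) : Prop :=
  ∀ (n : ℕ) (c : Fin n → X), ∃ (m : ℕ) (d : Fin m → Fin n → Y),
    ∀ p q, T (star (c p) * c q) = ∑ r, star (d r p) * d r q

namespace IsFamilyCP

section StarRing

variable {X Y Z : Type*} [NonUnitalRing X] [StarRing X] [NonUnitalRing Y] [StarRing Y]
  [NonUnitalRing Z] [StarRing Z]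

lemma of_fintype {T : X → Y}
    (h : ∀ (n : ℕ) (c : Fin n → X), ∃ (R : Type) (_ : Fintype R) (d : R → Fin n → Y),
      ∀ p q, T (star (c p) * c q) = ∑ r, star (d r p) * d r q) : IsFamilyCP T := by
  intro n c
  obtain ⟨R, _, d, hd⟩ := h n c
  refine ⟨Fintype.card R, fun r => d ((Fintype.equivFin R).symm r), fun p q => ?_⟩
  rw [hd, ← (Fintype.equivFin R).symm.sum_comp]

lemma of_isCompletelyPositive {T : X → Y} (hT : IsCompletelyPositive T) : IsFamilyCP T := by
  rintro (_ | n) c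
  · exact ⟨0, fun _ => Fin.elim0, fun p => Fin.elim0 p⟩
  · set C : Matrix (Fin (n + 1)) (Fin (n + 1)) X := fun i j => if i = 0 then c j else 0 with hC
    obtain ⟨d, hd⟩ := hT (n + 1) _ ⟨C, rfl⟩
    refine ⟨n + 1, d, fun p q => ?_⟩
    have := congrFun (congrFun hd p) q
    simp only [Matrix.map_apply, Matrix.mul_apply, Matrix.conjTranspose_apply] at this
    rw [← this]
    congr 1
    rw [Finset.sum_eq_single 0]
    · simp [hC]
    · intro b _ hb
      simp [hC, hb]
    · simp

lemma comp {S : Y → Z} {T : X → Y} (hS : IsFamilyCP S) (hadd : ∀ a b, S (a + b) = S a + S b)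
    (hT : IsFamilyCP T) : IsFamilyCP (fun x => S (T x)) := by
  refine of_fintype fun n c => ?_
  obtain ⟨m, d, hd⟩ := hT n c
  choose k e he using fun r => hS n (d r)
  refine ⟨Σ r, Fin (k r), inferInstance, fun r => e r.1 r.2, fun p q => ?_⟩
  let S' : Y →+ Z := AddMonoidHom.mk' S hadd
  have : S (∑ r, star (d r p) * d r q) = ∑ r, S (star (d r p) * d r q) := map_sum S' _ _
  rw [hd, this, Fintype.sum_sigma]
  exact Finset.sum_congr rfl fun r _ => he r p q

lemma add {S T : X → Y} (hS : IsFamilyCP S) (hT : IsFamilyCP T) :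
    IsFamilyCP (fun x => S x + T x) := by
  refine of_fintype fun n c => ?_
  obtain ⟨m, d, hd⟩ := hS n c
  obtain ⟨k, e, he⟩ := hT n c
  refine ⟨Fin m ⊕ Fin k, inferInstance, Sum.elim d e, fun p q => ?_⟩
  simp [hd, he]

lemma zero : IsFamilyCP (fun _ : X => (0 : Y)) := fun _ _ => ⟨0, fun r => Fin.elim0 r, by simp⟩

lemma sum {κ : Type*} (s : Finset κ) {T : κ → X → Y} (hT : ∀ i ∈ s, IsFamilyCP (T i)) :
    IsFamilyCP (fun x => ∑ i ∈ s, T i x) := by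
  classical
  induction s using Finset.induction_on with
  | empty => simpa using zero
  | insert a s ha ih =>
    simp only [Finset.sum_insert ha]
    exact (hT a (by simp)).add (ih fun i hi => hT i (by simp [hi]))

lemma conj {T : X → Y} (hT : IsFamilyCP T) (a : Y) : IsFamilyCP (fun x => star a * T x * a) := by
  intro n c
  obtain ⟨m, d, hd⟩ := hT n c
  exact ⟨m, fun r p => d r p * a, fun p q => by
    simp [hd, Finset.mul_sum, Finset.sum_mul, mul_assoc]⟩

lemma of_starHom {F : Type*} [FunLike F X Y] [MulHomClass F X Y] [StarHomClass F X Y]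
    (f : F) : IsFamilyCP f :=
  fun n c => ⟨1, fun _ p => f (c p), fun p q => by simp [map_star]⟩

lemma smul [Module ℂ Y] [StarModule ℂ Y] [IsScalarTower ℂ Y Y] [SMulCommClass ℂ Y Y]
    {T : X → Y} (hT : IsFamilyCP T) {t : ℝ} (ht : 0 ≤ t) :
    IsFamilyCP (fun x => (t : ℂ) • T x) := by
  intro n c
  obtain ⟨m, d, hd⟩ := hT n c
  refine ⟨m, fun r p => ((√t : ℝ) : ℂ) • d r p, fun p q => ?_⟩
  beta_reduce
  rw [hd, Finset.smul_sum]
  refine Finset.sum_congr rfl fun r _ => ?_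
  rw [star_smul, smul_mul_smul_comm, Complex.star_def, Complex.conj_ofReal, ← Complex.ofReal_mul,
    Real.mul_self_sqrt ht]

end StarRing

section Unital

variable {X Y : Type*} [Ring X] [StarRing X] [Ring Y] [StarRing Y]

lemma map_star {T : X → Y} (hT : IsFamilyCP T) (x : X) : T (star x) = star (T x) := by
  obtain ⟨m, d, hd⟩ := hT 2 ![1, x]
  have h1 := hd 0 1
  have h2 := hd 1 0
  simp only [Matrix.cons_val_zero, Matrix.cons_val_one, star_one, one_mul, mul_one] at h1 h2
  simp [h1, h2]

/-- The defect in the Kadison–Schwarz inequality is a sum of squares. -/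
lemma exists_schwarz {T : X → Y} (hT : IsFamilyCP T) (x : X) :
    ∃ (m : ℕ) (e : Fin m → Y), T (star x * x) =
      star (T x) * T x + star (T x) * (1 - T 1) * T x + ∑ r, star (e r) * e r := by
  obtain ⟨m, d, hd⟩ := hT 2 ![1, x]
  have h0 := hd 0 0
  have h1 := hd 0 1
  have h2 := hd 1 0
  have h3 := hd 1 1
  have hs := hT.map_star x
  simp only [Matrix.cons_val_zero, Matrix.cons_val_one, star_one, one_mul, mul_one] at h0 h1 h2 h3
  refine ⟨m, fun r => d r 1 - d r 0 * T x, ?_⟩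
  have : ∑ r, star (d r 1 - d r 0 * T x) * (d r 1 - d r 0 * T x) =
      (∑ r, star (d r 1) * d r 1) - (∑ r, star (d r 1) * d r 0) * T x
        - star (T x) * (∑ r, star (d r 0) * d r 1)
        + star (T x) * (∑ r, star (d r 0) * d r 0) * T x := by
    simp only [Finset.mul_sum, Finset.sum_mul, ← Finset.sum_sub_distrib, ← Finset.sum_add_distrib]
    refine Finset.sum_congr rfl fun r _ => ?_
    simp only [star_sub, star_mul]
    noncomm_ring
  rw [this, ← h0, ← h1, ← h2, ← h3, hs]
  noncomm_ring

lemma map_star_mul_self_nonneg [PartialOrder Y] [StarOrderedRing Y] {T : X → Y}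
    (hT : IsFamilyCP T) (x : X) : 0 ≤ T (star x * x) := by
  obtain ⟨m, d, hd⟩ := hT 1 ![x]
  have := hd 0 0
  simp only [Matrix.cons_val_zero] at this
  rw [this]
  exact Finset.sum_nonneg fun r _ => star_mul_self_nonneg _

lemma star_map_mul_map_le [PartialOrder Y] [StarOrderedRing Y] {T : X → Y}
    (hT : IsFamilyCP T) (h1 : T 1 ≤ 1) (x : X) : star (T x) * T x ≤ T (star x * x) := by
  obtain ⟨m, e, he⟩ := hT.exists_schwarz x
  rw [he, add_assoc]
  refine le_add_of_nonneg_right (add_nonneg ?_ (Finset.sum_nonneg fun r _ => star_mul_self_nonneg _))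
  exact star_left_conjugate_nonneg (sub_nonneg.2 h1) _

end Unital

section CStar

variable {X Y : Type*} [CStarAlgebra X] [PartialOrder X] [StarOrderedRing X]
  [CStarAlgebra Y] [PartialOrder Y] [StarOrderedRing Y]

lemma map_nonneg {T : X → Y} (hT : IsFamilyCP T) {x : X} (hx : 0 ≤ x) : 0 ≤ T x := by
  obtain ⟨y, rfl⟩ := CStarAlgebra.nonneg_iff_eq_star_mul_self.1 hx
  exact hT.map_star_mul_self_nonneg y

lemma norm_map_le {T : X →ₗ[ℂ] Y} (hT : IsFamilyCP T) (h1 : T 1 ≤ 1) (x : X) :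
    ‖T x‖ ≤ ‖x‖ := by
  have h2 := hT.star_map_mul_map_le h1 x
  have h3 : T (star x * x) ≤ (algebraMap ℝ Y (‖x‖ ^ 2)) := by
    have h4 : star x * x ≤ algebraMap ℝ X (‖x‖ ^ 2) := by
      simpa [CStarRing.norm_star_mul_self, sq] using
        IsSelfAdjoint.le_algebraMap_norm_self (a := star x * x) (.star_mul_self x)
    have h5 := hT.map_nonneg (sub_nonneg.2 h4)
    rw [map_sub, sub_nonneg] at h5
    refine h5.trans ?_
    rw [Algebra.algebraMap_eq_smul_one, Algebra.algebraMap_eq_smul_one]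
    rw [LinearMap.map_smul_of_tower]
    exact smul_le_smul_of_nonneg_left h1 (by positivity)
  have h4 : ‖star (T x) * T x‖ ≤ ‖x‖ ^ 2 :=
    CStarAlgebra.norm_le_iff_le_algebraMap (star (T x) * T x) (by positivity) |>.2 (h2.trans h3)
  rw [CStarRing.norm_star_mul_self, ← sq] at h4
  exact le_of_sq_le_sq h4 (norm_nonneg _)

end CStar

end IsFamilyCP

lemma exists_eq_star_mul_self_of_nonneg {Z : Type*} [NonUnitalCStarAlgebra Z] [PartialOrder Z]
    [StarOrderedRing Z] {z : Z} (hz : 0 ≤ z) : ∃ d, z = star d * d :=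
  CStarAlgebra.nonneg_iff_eq_star_mul_self.1 hz

/-- Pointwise limits of maps that are completely positive on families are completely positive. -/
lemma isCompletelyPositive_of_tendsto {X Y : Type*} [NonUnitalRing X] [StarRing X]
    [NonUnitalCStarAlgebra Y] {κ : Type*} {l : Filter κ} [l.NeBot] {S : κ → X → Y} {T : X → Y}
    (hS : ∀ i, IsFamilyCP (S i)) (hSadd : ∀ i a b, S i (a + b) = S i a + S i b)
    (hT : ∀ x, Filter.Tendsto (fun i => S i x) l (nhds (T x))) : IsCompletelyPositive T := by
  let _ : PartialOrder Y := CStarAlgebra.spectralOrder Y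
  have _ : StarOrderedRing Y := CStarAlgebra.spectralOrderedRing Y
  rintro n _ ⟨c, rfl⟩
  have hpos : ∀ i, 0 ≤ CStarMatrix.ofMatrix ((c.conjTranspose * c).map (S i)) := by
    intro i
    choose m d hd using fun r => hS i n (c r)
    let S' : X →+ Y := AddMonoidHom.mk' (S i) (hSadd i)
    have hsum : ∀ f : Fin n → X, S i (∑ r, f r) = ∑ r, S i (f r) := fun f => map_sum S' _ _
    have : CStarMatrix.ofMatrix ((c.conjTranspose * c).map (S i)) = ∑ r, ∑ s : Fin (m r),
        CStarMatrix.ofMatrix (fun p q : Fin n => star (d r s p) * d r s q) := by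
      ext p q
      have e1 : CStarMatrix.ofMatrix ((c.conjTranspose * c).map (S i)) p q =
          ∑ r, ∑ s : Fin (m r), star (d r s p) * d r s q := by
        simp only [CStarMatrix.ofMatrix_apply, Matrix.map_apply, Matrix.mul_apply,
          Matrix.conjTranspose_apply, hsum, hd]
      rw [e1]
      let ev : CStarMatrix (Fin n) (Fin n) Y →+ Y :=
        AddMonoidHom.mk' (fun M => M p q) (fun _ _ => rfl)
      exact ((map_sum ev (fun r => ∑ s : Fin (m r), CStarMatrix.ofMatrix
        (fun p q : Fin n => star (d r s p) * d r s q)) Finset.univ).trans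
        (Finset.sum_congr rfl fun r _ => map_sum ev (fun s : Fin (m r) => CStarMatrix.ofMatrix
        (fun p q : Fin n => star (d r s p) * d r s q)) Finset.univ)).symm
    rw [this]
    refine Finset.sum_nonneg fun r _ => Finset.sum_nonneg fun s _ => ?_
    rcases n with _ | n
    · exact le_of_eq (by ext p; exact Fin.elim0 p)
    · have : CStarMatrix.ofMatrix (fun p q : Fin (n + 1) => star (d r s p) * d r s q) =
          star (CStarMatrix.ofMatrix (fun i j : Fin (n + 1) => if i = 0 then d r s j else 0)) *
          CStarMatrix.ofMatrix (fun i j : Fin (n + 1) => if i = 0 then d r s j else 0) := by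
        ext p q
        rw [CStarMatrix.mul_apply, Finset.sum_eq_single 0]
        · rfl
        · intro b _ hb
          change star (if b = 0 then d r s p else 0) * (if b = 0 then d r s q else 0) = 0
          simp [hb]
        · simp
      rw [this]
      exact star_mul_self_nonneg _
  have hlim : Filter.Tendsto (fun i => CStarMatrix.ofMatrix ((c.conjTranspose * c).map (S i))) l
      (nhds (CStarMatrix.ofMatrix ((c.conjTranspose * c).map T))) := by
    rw [CStarMatrix.ofMatrix_eq_ofMatrixL]
    refine (CStarMatrix.ofMatrixL.continuous.tendsto _).comp ?_
    exact tendsto_pi_nhds.2 fun p => tendsto_pi_nhds.2 fun q => hT _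
  have h0 := CStarAlgebra.isClosed_nonneg.mem_of_tendsto hlim (Filter.Eventually.of_forall hpos)
  obtain ⟨d, hd⟩ := exists_eq_star_mul_self_of_nonneg (Set.mem_ofPred.1 h0)
  exact ⟨CStarMatrix.ofMatrix.symm d, hd⟩

section

open scoped ComplexOrder

/-- A Hermitian sesquilinear form, conjugate-linear in the first variable. -/
structure IsHermForm {V : Type*} [AddCommGroup V] [Module ℂ V] (s : V → V → ℂ) : Prop where
  add_right : ∀ x y z, s x (y + z) = s x y + s x z
  smul_right : ∀ (t : ℂ) x y, s x (t • y) = t * s x y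
  conj_symm : ∀ x y, star (s y x) = s x y

namespace IsHermForm

variable {V : Type*} [AddCommGroup V] [Module ℂ V] {s t : V → V → ℂ}

lemma add_left (hs : IsHermForm s) (x y z : V) : s (x + y) z = s x z + s y z := by
  rw [← hs.conj_symm, hs.add_right, star_add, hs.conj_symm, hs.conj_symm]

lemma smul_left (hs : IsHermForm s) (c : ℂ) (x y : V) : s (c • x) y = star c * s x y := by
  rw [← hs.conj_symm, hs.smul_right, star_mul', hs.conj_symm]

/-- The linear functional `y ↦ s x y`. -/
def right (hs : IsHermForm s) (x : V) : V →ₗ[ℂ] ℂ where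
  toFun := s x
  map_add' := hs.add_right x
  map_smul' c y := hs.smul_right c x y

lemma sub_right (hs : IsHermForm s) (x y z : V) : s x (y - z) = s x y - s x z :=
  map_sub (hs.right x) y z

lemma sub_left (hs : IsHermForm s) (x y z : V) : s (x - y) z = s x z - s y z := by
  rw [← hs.conj_symm, hs.sub_right, star_sub, hs.conj_symm, hs.conj_symm]

lemma sum_right (hs : IsHermForm s) {κ : Type*} (F : Finset κ) (x : V) (y : κ → V) :
    s x (∑ i ∈ F, y i) = ∑ i ∈ F, s x (y i) := map_sum (hs.right x) _ _

lemma sum_left (hs : IsHermForm s) {κ : Type*} (F : Finset κ) (x : κ → V) (y : V) :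
    s (∑ i ∈ F, x i) y = ∑ i ∈ F, s (x i) y := by
  rw [← hs.conj_symm, hs.sum_right, star_sum]
  exact Finset.sum_congr rfl fun i _ => hs.conj_symm _ _

lemma sub (hs : IsHermForm s) (ht : IsHermForm t) : IsHermForm fun x y => s x y - t x y where
  add_right x y z := by rw [hs.add_right, ht.add_right]; ring
  smul_right c x y := by rw [hs.smul_right, ht.smul_right]; ring
  conj_symm x y := by rw [star_sub, hs.conj_symm, ht.conj_symm]

lemma comp (hs : IsHermForm s) {W : Type*} [AddCommGroup W] [Module ℂ W] (T : W →ₗ[ℂ] V) :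
    IsHermForm fun x y => s (T x) (T y) where
  add_right x y z := by rw [map_add, hs.add_right]
  smul_right c x y := by rw [map_smul, hs.smul_right]
  conj_symm x y := hs.conj_symm _ _

lemma re_comm (hs : IsHermForm s) (x y : V) : (s y x).re = (s x y).re := by
  rw [← hs.conj_symm x y]; simp

/-- The Cauchy–Schwarz inequality. -/
lemma norm_sq_le (hs : IsHermForm s) (h0 : ∀ x, 0 ≤ (s x x).re) (x y : V) :
    ‖s x y‖ ^ 2 ≤ (s x x).re * (s y y).re := by
  let c : PreInnerProductSpace.Core ℂ V :=
    { inner := s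
      conj_inner_symm := hs.conj_symm
      re_inner_nonneg := h0
      add_left := hs.add_left
      smul_left := fun x y r => hs.smul_left r x y }
  have h := @InnerProductSpace.Core.inner_mul_inner_self_le ℂ V _ _ _ c x y
  have hxy : ‖s x y‖ * ‖s y x‖ ≤ (s x x).re * (s y y).re := h
  rwa [← hs.conj_symm y x, norm_star, ← sq] at hxy

/-- A functional bounded with respect to a positive form is approximately represented by it. -/
lemma exists_norm_sq_sub_le (hs : IsHermForm s) (h0 : ∀ x, 0 ≤ (s x x).re) (f : V →ₗ[ℂ] ℂ)
    {C : ℝ} (hf : ∀ x, ‖f x‖ ^ 2 ≤ C * (s x x).re) {ε : ℝ} (hε : 0 < ε) :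
    ∃ c, ∀ x, ‖f x - s c x‖ ^ 2 ≤ ε * (s x x).re := by
  have hC : ∀ x, -(C ^ 2 + 1) ^ 2 ≤ (s x x).re - 2 * (f x).re := by
    intro x
    have h1 := hf x
    have h2 := Complex.re_le_norm (f x)
    have h3 := h0 x
    have h4 := norm_nonneg (f x)
    nlinarith [sq_nonneg (‖f x‖ - (C ^ 2 + 1)), sq_nonneg (C - 1), mul_nonneg h3 (sq_nonneg C),
      sq_nonneg C, mul_nonneg h3 (sq_nonneg (C - 1)), sq_nonneg ((s x x).re - ‖f x‖)]
  have hbdd : BddBelow (Set.range fun x => (s x x).re - 2 * (f x).re) :=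
    ⟨_, by rintro _ ⟨x, rfl⟩; exact hC x⟩
  obtain ⟨c, hc⟩ := exists_lt_of_ciInf_lt
    (lt_add_of_pos_right (⨅ x, ((s x x).re - 2 * (f x).re)) hε)
  have hvar : ∀ z, 2 * (f z - s c z).re ≤ (s z z).re + ε := by
    intro z
    have h1 := ciInf_le hbdd (c + z)
    have h2 : (s (c + z) (c + z)).re = (s c c).re + 2 * (s c z).re + (s z z).re := by
      rw [hs.add_right, hs.add_left, hs.add_left]
      simp only [Complex.add_re, hs.re_comm c z]
      ring
    simp only [h2, map_add, Complex.add_re] at h1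
    rw [Complex.sub_re]
    linarith
  refine ⟨c, fun x => ?_⟩
  set w := f x - s c x with hw
  have key : ∀ t : ℝ, 0 ≤ (‖w‖ ^ 2 * (s x x).re) * (t * t) + (-2 * ‖w‖ ^ 2) * t + ε := by
    intro t
    have h := hvar (((t : ℂ) * star w) • x)
    have e1 : f (((t : ℂ) * star w) • x) - s c (((t : ℂ) * star w) • x) =
        ((t * ‖w‖ ^ 2 : ℝ) : ℂ) := by
      rw [map_smul, hs.smul_right, smul_eq_mul, ← mul_sub, ← hw, mul_assoc, Complex.star_def,
        ← Complex.normSq_eq_conj_mul_self, Complex.normSq_eq_norm_sq]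
      push_cast
      rfl
    have e2 : (s (((t : ℂ) * star w) • x) (((t : ℂ) * star w) • x)).re =
        t ^ 2 * ‖w‖ ^ 2 * (s x x).re := by
      have : s (((t : ℂ) * star w) • x) (((t : ℂ) * star w) • x) =
          ((t ^ 2 * ‖w‖ ^ 2 : ℝ) : ℂ) * s x x := by
        rw [hs.smul_right, hs.smul_left, ← Complex.normSq_eq_norm_sq]
        push_cast
        rw [Complex.normSq_eq_conj_mul_self]
        simp only [star_mul', Complex.star_def, Complex.conj_ofReal, Complex.conj_conj]
        ring
      rw [this, Complex.re_ofReal_mul]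
    rw [e1, e2, Complex.ofReal_re] at h
    nlinarith
  have hd := discrim_le_zero key
  rw [discrim] at hd
  by_cases hw0 : ‖w‖ ^ 2 = 0
  · rw [hw0]; exact mul_nonneg hε.le (h0 x)
  · have hpos : 0 < ‖w‖ ^ 2 := lt_of_le_of_ne (by positivity) (Ne.symm hw0)
    have : ‖w‖ ^ 2 * (‖w‖ ^ 2) ≤ ‖w‖ ^ 2 * (ε * (s x x).re) := by nlinarith
    exact le_of_mul_le_mul_left this hpos

/-- A Hermitian form on a coordinate space is positive as soon as its eigenvalues are. -/
lemma nonneg_of_eigenvalues {J : Type*} [Fintype J] {s : (J → ℂ) → (J → ℂ) → ℂ}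
    (hs : IsHermForm s)
    (h : ∀ (v : J → ℂ) (μ : ℝ), v ≠ 0 → (∀ w, s v w = μ * (star v ⬝ᵥ w)) → 0 ≤ μ) (v : J → ℂ) :
    0 ≤ (s v v).re := by
  classical
  let H : Matrix J J ℂ := Matrix.of fun p q => s (Pi.single p 1) (Pi.single q 1)
  have hform : ∀ v w, s v w = star v ⬝ᵥ H.mulVec w := by
    intro v w
    have hexp : ∀ v : J → ℂ, v = ∑ p, v p • (Pi.single p 1 : J → ℂ) := fun v => by
      conv_lhs => rw [← Finset.univ_sum_single v]
      simp [← Pi.single_smul]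
    have hl : ∀ y, s v y = ∑ p, star (v p) * s (Pi.single p 1) y := by
      intro y
      rw [← hs.conj_symm]
      conv_lhs => rw [hexp v, hs.sum_right]
      rw [star_sum]
      refine Finset.sum_congr rfl fun p _ => ?_
      rw [hs.smul_right, star_mul', hs.conj_symm]
    rw [hl]
    simp only [dotProduct, Matrix.mulVec, H, Matrix.of_apply, Pi.star_apply]
    refine Finset.sum_congr rfl fun p _ => ?_
    congr 1
    conv_lhs => rw [hexp w, hs.sum_right]
    refine Finset.sum_congr rfl fun q _ => ?_
    rw [hs.smul_right, mul_comm]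
  have hH : H.IsHermitian := by
    ext p q
    simp [H, hs.conj_symm]
  have hpos : H.PosSemidef := by
    rw [hH.posSemidef_iff_eigenvalues_nonneg]
    intro j
    have e := hH.mulVec_eigenvectorBasis j
    refine h (hH.eigenvectorBasis j) _ ?_ fun w => ?_
    · intro h0
      have := hH.eigenvectorBasis.orthonormal.ne_zero j
      exact this (by ext i; exact congrFun h0 i)
    · rw [← hs.conj_symm, hform, e]
      simp [dotProduct_smul, ← Matrix.star_dotProduct_star]
  rw [hform]
  exact (hpos.re_dotProduct_nonneg v)

end IsHermForm

end

section

open scoped ComplexOrder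

section Trace

open Matrix

variable {ι : Type*} [Fintype ι]

lemma trace_conjTranspose_mul_self_nonneg (x : Matrix ι ι ℂ) : 0 ≤ (xᴴ * x).trace.re :=
  (Complex.nonneg_iff.1 (Matrix.posSemidef_conjTranspose_mul_self x).trace_nonneg).1

/-- The Hilbert–Schmidt form `(x, y) ↦ tr (r xᴴ r y)` attached to a Hermitian matrix `r`. -/
def traceForm (r x y : Matrix ι ι ℂ) : ℂ := (r * xᴴ * r * y).trace

lemma isHermForm_traceForm {r : Matrix ι ι ℂ} (hr : r.IsHermitian) : IsHermForm (traceForm r) where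
  add_right x y z := by simp [traceForm, mul_add]
  smul_right t x y := by simp [traceForm]
  conj_symm x y := by
    rw [traceForm, ← Matrix.trace_conjTranspose]
    simp only [conjTranspose_mul, conjTranspose_conjTranspose, hr.eq]
    simpa only [traceForm, mul_assoc] using Matrix.trace_mul_comm (xᴴ * r * y) r

lemma norm_trace_sq_le [DecidableEq ι] (x y : Matrix ι ι ℂ) :
    ‖(xᴴ * y).trace‖ ^ 2 ≤ (xᴴ * x).trace.re * (yᴴ * y).trace.re := by
  have h := (isHermForm_traceForm (ι := ι) isHermitian_one).norm_sq_le
    (fun x => by simpa [traceForm] using trace_conjTranspose_mul_self_nonneg x) x y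
  simpa [traceForm] using h

lemma traceForm_gram_nonneg {r : Matrix ι ι ℂ} (hr : r.IsHermitian) {n : ℕ}
    (c b : Fin n → Matrix ι ι ℂ) :
    0 ≤ (∑ p, ∑ q, traceForm r ((c p)ᴴ * c q) ((b p)ᴴ * b q)).re := by
  have h := trace_conjTranspose_mul_self_nonneg (∑ p, c p * r * (b p)ᴴ)
  convert h using 2
  simp only [conjTranspose_sum, conjTranspose_mul, conjTranspose_conjTranspose, hr.eq,
    Finset.sum_mul, Finset.mul_sum, Matrix.trace_sum]
  refine Finset.sum_congr rfl fun p _ => Finset.sum_congr rfl fun q _ => ?_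
  simp only [traceForm, conjTranspose_mul, conjTranspose_conjTranspose]
  simpa only [mul_assoc] using Matrix.trace_mul_comm (r * ((c q)ᴴ * (c p)) * r * (b p)ᴴ) (b q)

lemma norm_traceForm_sq_le [DecidableEq ι] {r : Matrix ι ι ℂ} (hr : r.IsHermitian)
    (x y : Matrix ι ι ℂ) :
    ‖traceForm r x y‖ ^ 2 ≤ (r * r * (x * xᴴ)).trace.re * (r * r * (yᴴ * y)).trace.re := by
  have h := norm_trace_sq_le (r * x) (y * r)
  simp only [conjTranspose_mul, hr.eq] at h
  have e1 : (xᴴ * r * (y * r)).trace = traceForm r x y := by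
    rw [traceForm, ← mul_assoc, Matrix.trace_mul_comm]; simp only [mul_assoc]
  have e2 : (xᴴ * r * (r * x)).trace = (r * r * (x * xᴴ)).trace := by
    rw [mul_assoc, Matrix.trace_mul_comm]; simp only [mul_assoc]
  have e3 : (r * yᴴ * (y * r)).trace = (r * r * (yᴴ * y)).trace := by
    rw [← mul_assoc, Matrix.trace_mul_comm]; simp only [mul_assoc]
  rwa [e1, e2, e3] at h

lemma traceForm_conjTranspose {r : Matrix ι ι ℂ} (hr : r.IsHermitian) (x y : Matrix ι ι ℂ) :
    traceForm r xᴴ yᴴ = star (traceForm r x y) := by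
  rw [traceForm, traceForm, ← Matrix.trace_conjTranspose]
  simp only [conjTranspose_mul, conjTranspose_conjTranspose, hr.eq]
  simpa only [mul_assoc] using Matrix.trace_mul_comm (r * x * r) yᴴ

lemma traceForm_mul_self {q : Matrix ι ι ℂ} (hq : q.IsHermitian) (x : Matrix ι ι ℂ) :
    traceForm (q * q) x x = ((q * x * q)ᴴ * (q * x * q)).trace := by
  simp only [traceForm, conjTranspose_mul, hq.eq]
  simpa only [mul_assoc] using Matrix.trace_mul_comm q (q * xᴴ * q * q * x)

lemma traceForm_self_nonneg {q : Matrix ι ι ℂ} (hq : q.IsHermitian) (x : Matrix ι ι ℂ) :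
    0 ≤ (traceForm (q * q) x x).re := by
  rw [traceForm_mul_self hq]
  exact trace_conjTranspose_mul_self_nonneg _

variable [DecidableEq ι]

lemma eq_of_traceForm_eq {q : Matrix ι ι ℂ} (hq : q.IsHermitian) (hu : IsUnit q)
    {x y : Matrix ι ι ℂ} (h : ∀ z, traceForm (q * q) z x = traceForm (q * q) z y) : x = y := by
  have hr : (q * q).IsHermitian := by rw [Matrix.IsHermitian, conjTranspose_mul, hq.eq]
  have h1 : traceForm (q * q) (x - y) (x - y) = 0 := by
    rw [(isHermForm_traceForm hr).sub_right, h, sub_self]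
  rw [traceForm_mul_self hq, Matrix.trace_conjTranspose_mul_self_eq_zero_iff,
    hu.mul_left_eq_zero, hu.mul_right_eq_zero] at h1
  exact sub_eq_zero.1 h1

/-- The symmetric trace form of `r` dominates every Hermitian form which is bounded by the two
one-sided forms of the density `r * r`. -/
lemma IsHermForm.re_le_traceForm {q : Matrix ι ι ℂ} (hq : q.IsHermitian) (hu : IsUnit q)
    {γ : Matrix ι ι ℂ → Matrix ι ι ℂ → ℂ} (hγ : IsHermForm γ)
    (hb : ∀ x y, ‖γ x y‖ ^ 2 ≤ (q * q * (q * q) * (x * xᴴ)).trace.re *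
      (q * q * (q * q) * (yᴴ * y)).trace.re) (x : Matrix ι ι ℂ) :
    (γ x x).re ≤ (traceForm (q * q) x x).re := by
  obtain ⟨u, hqu⟩ := hu
  set p : Matrix ι ι ℂ := ((u⁻¹ : (Matrix ι ι ℂ)ˣ) : Matrix ι ι ℂ) with hpu
  have hqp : q * p = 1 := by rw [← hqu, hpu, u.mul_inv]
  have hpq : p * q = 1 := by rw [← hqu, hpu, u.inv_mul]
  have hqp' : ∀ z, q * (p * z) = z := fun z => by rw [← mul_assoc, hqp, one_mul]
  have hpq' : ∀ z, p * (q * z) = z := fun z => by rw [← mul_assoc, hpq, one_mul]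
  have hp : pᴴ = p := by
    have : pᴴ * q = 1 := by
      rw [← hq.eq, ← conjTranspose_mul, hqp, conjTranspose_one]
    calc pᴴ = pᴴ * (q * p) := by rw [hqp, mul_one]
      _ = p := by rw [← mul_assoc, this, one_mul]
  have hq' := hq.eq
  let m : (ι × ι → ℂ) →ₗ[ℂ] Matrix ι ι ℂ :=
    { toFun := fun v => Matrix.of fun i j => v (i, j)
      map_add' := fun _ _ => rfl
      map_smul' := fun _ _ => rfl }
  have hm : ∀ v w, star v ⬝ᵥ w = ((m v)ᴴ * m w).trace := by
    intro v w
    simp only [dotProduct, Fintype.sum_prod_type, Matrix.trace, Matrix.diag, Matrix.mul_apply,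
      conjTranspose_apply, m, Pi.star_apply]
    exact Finset.sum_comm
  let v : ι × ι → ℂ := fun i => (q * x * q) i.1 i.2
  have hv : m v = q * x * q := rfl
  let L : Matrix ι ι ℂ →ₗ[ℂ] Matrix ι ι ℂ := LinearMap.mulLeft ℂ p ∘ₗ LinearMap.mulRight ℂ p
  have hL : ∀ z, L z = p * (z * p) := fun z => rfl
  have hdot : IsHermForm fun v w : ι × ι → ℂ => star v ⬝ᵥ w :=
    ⟨fun x y z => dotProduct_add _ _ _, fun t x y => by simp, fun x y => by
      simp [← Matrix.star_dotProduct_star]⟩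
  have key := (hdot.sub (hγ.comp (L ∘ₗ m))).nonneg_of_eigenvalues ?_ v
  · have e1 : L (m v) = x := by
      simp only [hL, hv, mul_assoc, hqp, mul_one, hpq']
    have e2 : star v ⬝ᵥ v = traceForm (q * q) x x := by
      rw [hm, hv, traceForm_mul_self hq]
    simp only [LinearMap.comp_apply, e1, e2, Complex.sub_re] at key
    linarith
  · intro v μ hv0 hvμ
    let X := m v
    let w : ι × ι → ℂ := fun i => (q * q * X * (p * p)) i.1 i.2
    have hw : m w = q * q * X * (p * p) := rfl
    have hμ := hvμ w
    simp only [LinearMap.comp_apply] at hμ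
    have hbd := hb (L (m v)) (L (m w))
    set T := star v ⬝ᵥ w with hT
    have eT : T = ((q * X * p)ᴴ * (q * X * p)).trace := by
      rw [hT, hm, hw]
      simp only [conjTranspose_mul, hq', hp, mul_assoc, X]
      simpa only [mul_assoc] using Matrix.trace_mul_comm ((m v)ᴴ * q * q * m v * p) p
    have e1 : (q * q * (q * q) * (L (m v) * (L (m v))ᴴ)).trace = T := by
      rw [eT, hL]
      simp only [conjTranspose_mul, hq', hp, mul_assoc, X, hqp']
      have := Matrix.trace_mul_comm (q * q * q * m v * p * p * (m v)ᴴ) p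
      simp only [mul_assoc, hpq'] at this
      rw [this]
      have := Matrix.trace_mul_comm (q * q * m v * p * p) (m v)ᴴ
      simp only [mul_assoc] at this
      rw [this]
      simpa only [mul_assoc] using Matrix.trace_mul_comm ((m v)ᴴ * q * q * m v * p) p
    have e2 : (q * q * (q * q) * ((L (m w))ᴴ * L (m w))).trace = T := by
      rw [eT, hL, hw]
      simp only [conjTranspose_mul, hq', hp, mul_assoc, X, hqp', hpq']
      have := Matrix.trace_mul_comm (q * (m v)ᴴ * q * q * m v * p * p) p
      simp only [mul_assoc, hpq'] at this
      rw [this]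
      simpa only [mul_assoc] using Matrix.trace_mul_comm ((m v)ᴴ * q * q * m v * p) p
    have hT0 : 0 < T := by
      rw [eT]
      refine lt_of_le_of_ne (Matrix.posSemidef_conjTranspose_mul_self _).trace_nonneg fun h0 => ?_
      have h1 := Matrix.trace_conjTranspose_mul_self_eq_zero_iff.1 h0.symm
      have h2 : X = 0 := by
        calc X = p * (q * X * p) * q := by simp only [mul_assoc, hpq, mul_one, hpq']
          _ = 0 := by rw [h1]; simp
      exact hv0 (funext fun i => congrFun (congrFun h2 i.1) i.2)
    obtain ⟨hTpos, hTim⟩ := Complex.pos_iff.1 hT0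
    replace hTim : T = (T.re : ℂ) := Complex.ext rfl hTim.symm
    have hγT : γ (L (m v)) (L (m w)) = ((1 - μ : ℝ) : ℂ) * T := by
      push_cast
      linear_combination -hμ
    rw [e1, e2, hγT, norm_mul, mul_pow, Complex.norm_real, hTim, Complex.norm_real,
      Real.norm_eq_abs, Real.norm_eq_abs, sq_abs, sq_abs, Complex.ofReal_re] at hbd
    by_contra hneg
    push Not at hneg
    nlinarith [mul_pos hTpos hTpos, mul_pos (mul_pos hTpos hTpos) (neg_pos.2 hneg)]

end Trace

end

section

open scoped ComplexOrder MatrixOrder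

/-- A positive linear functional on a *-algebra. -/
def IsPosFun {X : Type*} [Ring X] [StarRing X] [Algebra ℂ X] (f : X →ₗ[ℂ] ℂ) : Prop :=
  ∀ x, 0 ≤ f (star x * x)

namespace IsPosFun

section Star

variable {X : Type*} [Ring X] [StarRing X] [Algebra ℂ X] {f : X →ₗ[ℂ] ℂ}

lemma re_nonneg (hf : IsPosFun f) (x : X) : 0 ≤ (f (star x * x)).re :=
  (Complex.nonneg_iff.1 (hf x)).1

lemma re_one_nonneg (hf : IsPosFun f) : 0 ≤ (f 1).re := by simpa using hf.re_nonneg 1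

lemma map_one_eq (hf : IsPosFun f) : f 1 = ((f 1).re : ℂ) :=
  Complex.ext rfl (by simpa using (Complex.nonneg_iff.1 (hf 1)).2.symm)

variable [StarModule ℂ X]

lemma map_star (hf : IsPosFun f) (x : X) : f (star x) = star (f x) := by
  have h : ∀ t : ℂ, (f (star (1 + t • x) * (1 + t • x))).im = 0 :=
    fun t => (Complex.nonneg_iff.1 (hf _)).2.symm
  have h0 : (f 1).im = 0 := by simpa using h 0
  have hx : (f (star x * x)).im = 0 := (Complex.nonneg_iff.1 (hf x)).2.symm
  have e : ∀ t : ℂ, f (star (1 + t • x) * (1 + t • x)) =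
      f 1 + t * f x + star t * f (star x) + (star t * t) * f (star x * x) := by
    intro t
    have : star (1 + t • x) * (1 + t • x) =
        1 + t • x + star t • star x + (star t * t) • (star x * x) := by
      simp only [star_add, star_one, star_smul, add_mul, mul_add, one_mul, mul_one,
        smul_mul_smul_comm]
      abel
    rw [this]
    simp
  have h1 := h 1
  have h2 := h Complex.I
  rw [e] at h1 h2
  simp [h0, hx] at h1 h2
  apply Complex.ext <;> simp <;> linarith

lemma isHermForm (hf : IsPosFun f) : IsHermForm fun x y : X => f (star x * y) where
  add_right x y z := by rw [mul_add, map_add]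
  smul_right t x y := by rw [mul_smul_comm, map_smul, smul_eq_mul]
  conj_symm x y := by rw [← hf.map_star, star_mul, star_star]

lemma norm_sq_le (hf : IsPosFun f) (x : X) : ‖f x‖ ^ 2 ≤ (f 1).re * (f (star x * x)).re := by
  simpa using hf.isHermForm.norm_sq_le hf.re_nonneg 1 x

end Star

section CStar

variable {X : Type*} [CStarAlgebra X] [PartialOrder X] [StarOrderedRing X] {f : X →ₗ[ℂ] ℂ}

lemma map_nonneg (hf : IsPosFun f) {x : X} (hx : 0 ≤ x) : 0 ≤ f x := by
  obtain ⟨y, rfl⟩ := CStarAlgebra.nonneg_iff_eq_star_mul_self.1 hx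
  exact hf y

lemma re_mono (hf : IsPosFun f) {x y : X} (h : x ≤ y) : (f x).re ≤ (f y).re := by
  have := (Complex.nonneg_iff.1 (hf.map_nonneg (sub_nonneg.2 h))).1
  rw [map_sub, Complex.sub_re] at this
  linarith

lemma re_star_mul_self_le (hf : IsPosFun f) (x : X) :
    (f (star x * x)).re ≤ (f 1).re * ‖x‖ ^ 2 := by
  have h4 : star x * x ≤ algebraMap ℝ X (‖x‖ ^ 2) := by
    simpa [CStarRing.norm_star_mul_self, sq] using
      IsSelfAdjoint.le_algebraMap_norm_self (a := star x * x) (.star_mul_self x)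
  have h := hf.re_mono h4
  rw [Algebra.algebraMap_eq_smul_one, LinearMap.map_smul_of_tower, Complex.real_smul,
    Complex.re_ofReal_mul] at h
  linarith

lemma norm_le (hf : IsPosFun f) (x : X) : ‖f x‖ ≤ (f 1).re * ‖x‖ := by
  refine le_of_sq_le_sq ?_ (mul_nonneg hf.re_one_nonneg (norm_nonneg x))
  refine (hf.norm_sq_le x).trans ?_
  rw [mul_pow, sq (f 1).re, mul_assoc]
  exact mul_le_mul_of_nonneg_left (hf.re_star_mul_self_le x) hf.re_one_nonneg

lemma continuous (hf : IsPosFun f) : Continuous f :=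
  AddMonoidHomClass.continuous_of_bound f _ hf.norm_le

end CStar

end IsPosFun

section Density

open Matrix

variable {ι : Type*} [Fintype ι] [DecidableEq ι]

/-- A matrix with one single nonzero row. -/
lemma conjTranspose_mul_row (k : ι) (v w : ι → ℂ) :
    (Matrix.of fun i j => if i = k then v j else 0)ᴴ * (Matrix.of fun i j => if i = k then w j else 0)
      = Matrix.of fun i j => star (v i) * w j := by
  ext i j
  rw [Matrix.mul_apply, Finset.sum_eq_single k]
  · simp
  · intro b _ hb
    simp [hb]
  · simp

lemma exists_density {h : Matrix ι ι ℂ →ₗ[ℂ] ℂ} {κ : ℝ} (hκ : 0 < κ)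
    (hh : ∀ T, (κ : ℂ) * (Tᴴ * T).trace ≤ h (Tᴴ * T)) :
    ∃ q : Matrix ι ι ℂ, q.IsHermitian ∧ IsUnit q ∧ ∀ T, h T = (q * q * (q * q) * T).trace := by
  let ρ : Matrix ι ι ℂ := Matrix.of fun i j => h (Matrix.single j i 1)
  have hρ : ∀ T, h T = (ρ * T).trace := by
    intro T
    conv_lhs => rw [Matrix.matrix_eq_sum_single T]
    simp only [map_sum, Matrix.trace, Matrix.diag, Matrix.mul_apply, ρ, of_apply]
    rw [Finset.sum_comm]
    refine Finset.sum_congr rfl fun i _ => Finset.sum_congr rfl fun j _ => ?_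
    rw [show Matrix.single j i (T j i) = T j i • Matrix.single j i (1 : ℂ) by simp, map_smul,
      smul_eq_mul, mul_comm]
  have hpd : ∀ v : ι → ℂ, (κ : ℂ) * (star v ⬝ᵥ v) ≤ star v ⬝ᵥ ρ *ᵥ v := by
    intro v
    rcases isEmpty_or_nonempty ι with hι | ⟨⟨k⟩⟩
    · simp
    have := hh (Matrix.of fun i j => if i = k then star (v j) else 0)
    rw [conjTranspose_mul_row, hρ] at this
    convert this using 1
    · simp only [dotProduct, Matrix.trace, Matrix.diag, of_apply, Pi.star_apply, star_star,
        mul_comm]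
    · simp only [dotProduct, Matrix.trace, Matrix.diag, of_apply, Pi.star_apply, star_star,
        Matrix.mul_apply, Matrix.mulVec, Finset.mul_sum]
      refine Finset.sum_congr rfl fun i _ => Finset.sum_congr rfl fun j _ => by ring
  have hpos : IsPosFun h := fun T => (mul_nonneg (by exact_mod_cast hκ.le)
    (Matrix.posSemidef_conjTranspose_mul_self T).trace_nonneg).trans (hh T)
  have hPD : ρ.PosDef := by
    refine .of_dotProduct_mulVec_pos ?_ fun v hv => lt_of_lt_of_le ?_ (hpd v)
    · ext i j
      simp only [conjTranspose_apply, ρ, of_apply, ← hpos.map_star]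
      simp [Matrix.star_eq_conjTranspose]
    · exact mul_pos (by exact_mod_cast hκ) (dotProduct_star_self_pos_iff.2 hv)
  have hsq : ∀ σ : Matrix ι ι ℂ, σ.PosDef → ∃ τ : Matrix ι ι ℂ, τ.PosDef ∧ τ * τ = σ := by
    intro σ hσ
    have hmul : CFC.sqrt σ * CFC.sqrt σ = σ := CFC.sqrt_mul_sqrt_self σ hσ.posSemidef.nonneg
    refine ⟨CFC.sqrt σ, ?_, hmul⟩
    refine (CFC.sqrt_nonneg σ).posSemidef.posDef_iff_isUnit.2 ?_
    have h1 : IsUnit (CFC.sqrt σ * CFC.sqrt σ) := by rw [hmul]; exact hσ.isUnit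
    exact ((Commute.refl _).isUnit_mul_iff.1 h1).1
  obtain ⟨r, hr, hrρ⟩ := hsq _ hPD
  obtain ⟨q, hq, rfl⟩ := hsq _ hr
  exact ⟨q, hq.isHermitian, hq.isUnit, by rwa [hrρ]⟩

end Density

end

section

open scoped ComplexOrder
open Filter Topology

/-- A completely positive factorisation through a matrix algebra, whose second leg is faithful. -/
structure MatrixFactorization (A : Type*) [CStarAlgebra A] [PartialOrder A] where
  ι : Type
  [fintype : Fintype ι]
  [decEq : DecidableEq ι]
  φ : A →ₗ[ℂ] Matrix ι ι ℂ
  ψ : Matrix ι ι ℂ →ₗ[ℂ] A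
  φ_cp : IsFamilyCP φ
  φ_one : φ 1 = 1
  ψ_cp : IsFamilyCP ψ
  ψ_one : ψ 1 ≤ 1
  κ : ℝ
  κ_pos : 0 < κ
  ψ_faithful : ∀ T, ((κ : ℂ) * (star T * T).trace) • (1 : A) ≤ ψ (star T * T)

attribute [instance] MatrixFactorization.fintype MatrixFactorization.decEq

namespace MatrixFactorization

variable {A : Type*} [CStarAlgebra A] [PartialOrder A] [StarOrderedRing A]

lemma exists_density (N : MatrixFactorization A) {g : A →ₗ[ℂ] ℂ} (hg : IsPosFun g) (h1 : g 1 = 1) :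
    ∃ q : Matrix N.ι N.ι ℂ, q.IsHermitian ∧ IsUnit q ∧
      ∀ T, g (N.ψ T) = (q * q * (q * q) * T).trace := by
  refine _root_.exists_density (h := g ∘ₗ N.ψ) N.κ_pos fun T => ?_
  have h := hg.map_nonneg (sub_nonneg.2 (N.ψ_faithful T))
  rw [map_sub, map_smul, h1, smul_eq_mul, mul_one, sub_nonneg] at h
  exact h

lemma re_map_star_mul_le (N : MatrixFactorization A) {g : A →ₗ[ℂ] ℂ} (hg : IsPosFun g) (x : A) :
    (g (N.ψ (star (N.φ x) * N.φ x))).re ≤ (g (N.ψ (N.φ (star x * x)))).re := by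
  obtain ⟨m, e, he⟩ := N.φ_cp.exists_schwarz x
  rw [he, N.φ_one]
  simp only [sub_self, mul_zero, zero_mul, add_zero, map_add, map_sum, Complex.add_re,
    Complex.re_sum]
  refine le_add_of_nonneg_right (Finset.sum_nonneg fun r _ => ?_)
  exact (Complex.nonneg_iff.1 (hg.map_nonneg (N.ψ_cp.map_star_mul_self_nonneg _))).1

lemma re_star_mul_map_le (N : MatrixFactorization A) {g : A →ₗ[ℂ] ℂ} (hg : IsPosFun g)
    (x : Matrix N.ι N.ι ℂ) :
    (g (star (N.ψ x) * N.ψ x)).re ≤ (g (N.ψ (star x * x))).re :=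
  hg.re_mono (N.ψ_cp.star_map_mul_map_le N.ψ_one x)

end MatrixFactorization

section LimitForm

variable {A : Type*} [CStarAlgebra A] [PartialOrder A] [StarOrderedRing A]
  {I : Type*} {U : Ultrafilter I} {N : I → MatrixFactorization A} {g : A →ₗ[ℂ] ℂ}

lemma exists_tendsto_of_norm_le {f : I → ℂ} {C : ℝ} (h : ∀ᶠ i in (U : Filter I), ‖f i‖ ≤ C) :
    ∃ z, Tendsto f U (𝓝 z) := by
  obtain ⟨z, -, hz⟩ := (isCompact_closedBall (0 : ℂ) C).ultrafilter_le_nhds (U.map f)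
    (by
      rw [Filter.le_principal_iff, Ultrafilter.coe_map, Filter.mem_map]
      filter_upwards [h] with i hi using by simpa using hi)
  exact ⟨z, hz⟩

lemma sum_comm_pairs {P R V W : Type*} [Fintype P] [Fintype R] [Fintype V] [Fintype W]
    (f : P → R → V → W → ℂ) :
    ∑ p, ∑ r, ∑ w, ∑ v, f p r v w = ∑ v, ∑ w, ∑ p, ∑ r, f p r v w := by
  calc _ = ∑ x : P × R, ∑ y : V × W, f x.1 x.2 y.1 y.2 := by
        simp only [Fintype.sum_prod_type]
        exact Finset.sum_congr rfl fun p _ => Finset.sum_congr rfl fun r _ => Finset.sum_comm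
    _ = _ := by
        rw [Finset.sum_comm]
        simp only [Fintype.sum_prod_type]

/-- The trace forms of the densities of a state converge along an ultrafilter. -/
lemma exists_limit_form (hN : ∀ x, Tendsto (fun i => (N i).ψ ((N i).φ x)) U (𝓝 x))
    (hg : IsPosFun g) (q : ∀ i, Matrix (N i).ι (N i).ι ℂ)
    (hq : ∀ i, (q i).IsHermitian)
    (hqg : ∀ i T, g ((N i).ψ T) = (q i * q i * (q i * q i) * T).trace) :
    ∃ s : A → A → ℂ, IsHermForm s ∧ (∀ x, 0 ≤ (s x x).re) ∧
      (∀ x y, Tendsto (fun i => traceForm (q i * q i) ((N i).φ x) ((N i).φ y)) U (𝓝 (s x y))) ∧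
      (∀ x y, ‖s x y‖ ^ 2 ≤ (g (x * star x)).re * (g (star y * y)).re) ∧
      (∀ x, s x 1 = g (star x)) ∧ (∀ x y, s (star x) (star y) = star (s x y)) ∧
      ∀ (n : ℕ) (c b : Fin n → A), 0 ≤ (∑ p, ∑ r, s (star (c p) * c r) (star (b p) * b r)).re := by
  have hr : ∀ i, (q i * q i).IsHermitian := fun i => by
    rw [Matrix.IsHermitian, Matrix.conjTranspose_mul, (hq i).eq]
  have hbd : ∀ i x y, ‖traceForm (q i * q i) ((N i).φ x) ((N i).φ y)‖ ^ 2 ≤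
      (g ((N i).ψ ((N i).φ (x * star x)))).re * (g ((N i).ψ ((N i).φ (star y * y)))).re := by
    intro i x y
    refine (norm_traceForm_sq_le (hr i) _ _).trans ?_
    rw [← hqg, ← hqg]
    have h1 := (N i).re_map_star_mul_le hg (star x)
    have h2 := (N i).re_map_star_mul_le hg y
    rw [(N i).φ_cp.map_star, star_star, star_star] at h1
    refine mul_le_mul h1 h2 ?_ ?_
    · exact (Complex.nonneg_iff.1 (hg.map_nonneg ((N i).ψ_cp.map_star_mul_self_nonneg _))).1
    · have h := ((N i).ψ_cp.comp (map_add _) (N i).φ_cp).map_star_mul_self_nonneg (star x)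
      rw [star_star] at h
      exact (Complex.nonneg_iff.1 (hg.map_nonneg h)).1
  have hlim : ∀ x y, Tendsto (fun i => (g ((N i).ψ ((N i).φ (x * star x)))).re *
      (g ((N i).ψ ((N i).φ (star y * y)))).re) U (𝓝 ((g (x * star x)).re * (g (star y * y)).re)) :=
    fun x y => ((Complex.continuous_re.tendsto _).comp ((hg.continuous.tendsto _).comp (hN _))).mul
      ((Complex.continuous_re.tendsto _).comp ((hg.continuous.tendsto _).comp (hN _)))
  have hex : ∀ x y, ∃ z, Tendsto (fun i => traceForm (q i * q i) ((N i).φ x) ((N i).φ y)) U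
      (𝓝 z) := by
    intro x y
    refine exists_tendsto_of_norm_le (C := (g (x * star x)).re * (g (star y * y)).re + 1 + 1) ?_
    filter_upwards [(hlim x y).eventually_lt_const (lt_add_one _)] with i hi
    nlinarith [hbd i x y, sq_nonneg (‖traceForm (q i * q i) ((N i).φ x) ((N i).φ y)‖ - 1)]
  choose s hs using hex
  have hform : IsHermForm s := by
    refine ⟨fun x y z => ?_, fun t x y => ?_, fun x y => ?_⟩
    · refine tendsto_nhds_unique (hs x (y + z)) (((hs x y).add (hs x z)).congr fun i => ?_)
      rw [map_add, (isHermForm_traceForm (hr i)).add_right]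
    · refine tendsto_nhds_unique (hs x (t • y)) (((hs x y).const_mul t).congr fun i => ?_)
      rw [map_smul, (isHermForm_traceForm (hr i)).smul_right]
    · refine tendsto_nhds_unique ((continuous_star.tendsto _).comp (hs y x))
        ((hs x y).congr fun i => ?_)
      exact ((isHermForm_traceForm (hr i)).conj_symm _ _).symm
  have hgram : ∀ (n : ℕ) (c b : Fin n → A),
      0 ≤ (∑ p, ∑ r, s (star (c p) * c r) (star (b p) * b r)).re := by
    intro n c b
    have ht : Tendsto (fun i => (∑ p, ∑ r, traceForm (q i * q i) ((N i).φ (star (c p) * c r))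
        ((N i).φ (star (b p) * b r))).re) U
        (𝓝 (∑ p, ∑ r, s (star (c p) * c r) (star (b p) * b r)).re) :=
      (Complex.continuous_re.tendsto _).comp
        (tendsto_finsetSum _ fun p _ => tendsto_finsetSum _ fun r _ => hs _ _)
    refine ge_of_tendsto' ht fun i => ?_
    obtain ⟨m, d, hd⟩ := (N i).φ_cp n c
    obtain ⟨k, e, he⟩ := (N i).φ_cp n b
    have hT := isHermForm_traceForm (hr i)
    have : ∑ p, ∑ r, traceForm (q i * q i) ((N i).φ (star (c p) * c r))
        ((N i).φ (star (b p) * b r)) = ∑ u, ∑ v, ∑ p, ∑ r, traceForm (q i * q i)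
          ((d u p).conjTranspose * d u r) ((e v p).conjTranspose * e v r) := by
      simp only [hd, he, hT.sum_right, hT.sum_left, Matrix.star_eq_conjTranspose]
      exact sum_comm_pairs _
    rw [this, Complex.re_sum]
    refine Finset.sum_nonneg fun u _ => ?_
    rw [Complex.re_sum]
    exact Finset.sum_nonneg fun v _ => traceForm_gram_nonneg (hr i) _ _
  refine ⟨s, hform, fun x => ?_, hs, fun x y => ?_, fun x => ?_, fun x y => ?_, hgram⟩
  · exact ge_of_tendsto' ((Complex.continuous_re.tendsto _).comp (hs x x))
      fun i => traceForm_self_nonneg (hq i) _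
  · exact le_of_tendsto_of_tendsto' (((continuous_norm.tendsto _).comp (hs x y)).pow 2) (hlim x y)
      fun i => hbd i x y
  · refine tendsto_nhds_unique (hs x 1) (((hg.continuous.tendsto _).comp (hN (star x))).congr
      fun i => ?_)
    simp only [Function.comp_apply, hqg, (N i).φ_one, traceForm, mul_one]
    rw [(N i).φ_cp.map_star, Matrix.star_eq_conjTranspose]
    simpa only [mul_assoc] using
      Matrix.trace_mul_comm (q i * q i) (q i * q i * ((N i).φ x).conjTranspose)
  · refine tendsto_nhds_unique (hs (star x) (star y)) (((continuous_star.tendsto _).comp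
      (hs x y)).congr fun i => ?_)
    rw [(N i).φ_cp.map_star, (N i).φ_cp.map_star]
    exact (traceForm_conjTranspose (hr i) _ _).symm

end LimitForm

end

section

open scoped ComplexOrder MatrixOrder
open Filter Topology

lemma IsFamilyCP.exists_of_fintype {X Y : Type*} [NonUnitalRing X] [StarRing X] [NonUnitalRing Y]
    [StarRing Y] {T : X → Y} (hT : IsFamilyCP T) {P : Type*} [Fintype P] (c : P → X) :
    ∃ (m : ℕ) (d : Fin m → P → Y), ∀ p q, T (star (c p) * c q) = ∑ r, star (d r p) * d r q := by
  obtain ⟨m, d, hd⟩ := hT (Fintype.card P) (c ∘ (Fintype.equivFin P).symm)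
  exact ⟨m, fun r p => d r (Fintype.equivFin P p), fun p q => by simp [← hd]⟩

section Riesz

open Matrix

variable {B : Type*} [Ring B] [StarRing B] [Algebra ℂ B] [StarModule ℂ B] {s : B → B → ℂ}

/-- Pairing a completely positive map out of a matrix algebra with a form which is positive on
Gram matrices is completely positive in the remaining variable. -/
lemma isFamilyCP_pairing (hs : IsHermForm s) (hstar : ∀ x y, s (star x) (star y) = star (s x y))
    (hgram : ∀ (n : ℕ) (c b : Fin n → B),
      0 ≤ (∑ p, ∑ r, s (star (c p) * c r) (star (b p) * b r)).re)
    {ι : Type} [Fintype ι] [DecidableEq ι] {T : Matrix ι ι ℂ →ₗ[ℂ] B} (hT : IsFamilyCP T) :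
    IsFamilyCP fun b => (Matrix.of fun i j => s (T (Matrix.single i j 1)) b : Matrix ι ι ℂ) := by
  refine IsFamilyCP.of_fintype fun n b => ?_
  let H : Matrix (Fin n × ι) (Fin n × ι) ℂ :=
    Matrix.of fun x y => s (T (Matrix.single x.2 y.2 1)) (star (b x.1) * b y.1)
  have hH : H.IsHermitian := by
    ext x y
    simp only [conjTranspose_apply, H, of_apply]
    rw [← hstar, ← hT.map_star, star_mul, star_star]
    simp [Matrix.star_eq_conjTranspose]
  have hpos : H.PosSemidef := by
    refine .of_dotProduct_mulVec_nonneg hH fun v => ?_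
    refine Complex.nonneg_iff.2 ⟨?_, (hH.im_star_dotProduct_mulVec_self v).symm⟩
    rcases isEmpty_or_nonempty ι with hι | ⟨⟨k⟩⟩
    · simp [dotProduct]
    obtain ⟨m, d, hd⟩ := hT.exists_of_fintype fun i => Matrix.single k i (1 : ℂ)
    have hd' : ∀ i j, T (Matrix.single i j 1) = ∑ r, star (d r i) * d r j := fun i j => by
      rw [← hd]; simp [Matrix.star_eq_conjTranspose]
    have : star v ⬝ᵥ H *ᵥ v = ∑ r : Fin m, ∑ x : Fin n × ι, ∑ y : Fin n × ι,
        s (star (d r x.2) * d r y.2) (star (v x • b x.1) * (v y • b y.1)) := by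
      simp only [dotProduct, mulVec, H, of_apply, hd', hs.sum_left, Finset.mul_sum,
        Finset.sum_mul, Pi.star_apply]
      rw [Finset.sum_comm_cycle]
      refine Finset.sum_congr rfl fun r _ => Finset.sum_congr rfl fun x _ =>
        Finset.sum_congr rfl fun y _ => ?_
      rw [star_smul, smul_mul_smul_comm, hs.smul_right]
      ring
    rw [this, Complex.re_sum]
    refine Finset.sum_nonneg fun r _ => ?_
    let e := Fintype.equivFin (Fin n × ι)
    have := hgram _ (fun t => d r (e.symm t).2) (fun t => v (e.symm t) • b (e.symm t).1)
    rw [e.symm.sum_comp (fun x => ∑ y, s (star (d r x.2) * d r (e.symm y).2)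
      (star (v x • b x.1) * (v (e.symm y) • b (e.symm y).1)))] at this
    refine this.trans_eq (congrArg _ (Finset.sum_congr rfl fun x _ => ?_))
    exact e.symm.sum_comp (fun y => s (star (d r x.2) * d r y.2)
      (star (v x • b x.1) * (v y • b y.1)))
  obtain ⟨R, hR⟩ := CStarAlgebra.nonneg_iff_eq_star_mul_self.mp hpos.nonneg
  refine ⟨Fin n × ι, inferInstance, fun m p => Matrix.of fun k i => if k = m.2 then R m (p, i) else 0,
    fun p q => ?_⟩
  simp only [Matrix.star_eq_conjTranspose, conjTranspose_mul_row]
  ext i j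
  rw [Matrix.sum_apply]
  have := congrFun (congrFun hR (p, i)) (q, j)
  rw [Matrix.star_eq_conjTranspose, Matrix.mul_apply] at this
  exact this

lemma exists_riesz_matrix (hs : IsHermForm s)
    (hstar : ∀ x y, s (star x) (star y) = star (s x y))
    (hgram : ∀ (n : ℕ) (c b : Fin n → B),
      0 ≤ (∑ p, ∑ r, s (star (c p) * c r) (star (b p) * b r)).re)
    {ι : Type} [Fintype ι] [DecidableEq ι] {T : Matrix ι ι ℂ →ₗ[ℂ] B} (hT : IsFamilyCP T)
    {q : Matrix ι ι ℂ} (hq : q.IsHermitian) (hu : IsUnit q)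
    (hone : ∀ z, s (T z) 1 = (q * q * (q * q) * zᴴ).trace) :
    ∃ y : B →ₗ[ℂ] Matrix ι ι ℂ, IsFamilyCP y ∧ y 1 = 1 ∧
      ∀ z b, traceForm (q * q) z (y b) = s (T z) b := by
  have hr : (q * q).IsHermitian := by rw [Matrix.IsHermitian, conjTranspose_mul, hq.eq]
  obtain ⟨u, hu'⟩ := hu.mul hu
  set p : Matrix ι ι ℂ := ((u⁻¹ : (Matrix ι ι ℂ)ˣ) : Matrix ι ι ℂ)
  have h1 : q * q * p = 1 := by rw [← hu', u.mul_inv]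
  have h2 : p * (q * q) = 1 := by rw [← hu', u.inv_mul]
  have hp : pᴴ = p := by
    have : pᴴ * (q * q) = 1 := by rw [← hr.eq, ← conjTranspose_mul, h1, conjTranspose_one]
    calc pᴴ = pᴴ * (q * q * p) := by rw [h1, mul_one]
      _ = p := by rw [← mul_assoc, this, one_mul]
  let D : B →ₗ[ℂ] Matrix ι ι ℂ :=
    { toFun := fun b => Matrix.of fun i j => s (T (Matrix.single i j 1)) b
      map_add' := fun a b => by ext i j; exact hs.add_right _ _ _
      map_smul' := fun t b => by ext i j; exact hs.smul_right _ _ _ }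
  have hD : IsFamilyCP D := isFamilyCP_pairing hs hstar hgram hT
  let y : B →ₗ[ℂ] Matrix ι ι ℂ := LinearMap.mulLeft ℂ p ∘ₗ LinearMap.mulRight ℂ p ∘ₗ D
  have hy : ∀ z b, traceForm (q * q) z (y b) = s (T z) b := by
    intro z b
    have e1 : traceForm (q * q) z (y b) = (zᴴ * D b).trace := by
      have e0 : y b = p * (D b * p) := rfl
      rw [traceForm, e0]
      have : q * q * zᴴ * (q * q) * (p * (D b * p)) = q * q * (zᴴ * D b * p) := by
        rw [mul_assoc _ (q * q), ← mul_assoc (q * q) p, h1, one_mul]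
        simp only [mul_assoc]
      rw [this, Matrix.trace_mul_comm, mul_assoc, h2, mul_one]
    rw [e1]
    conv_rhs => rw [Matrix.matrix_eq_sum_single z, map_sum, hs.sum_left]
    simp only [map_sum, hs.sum_left, Matrix.trace, Matrix.diag, Matrix.mul_apply]
    rw [Finset.sum_comm]
    refine Finset.sum_congr rfl fun i _ => Finset.sum_congr rfl fun j _ => ?_
    rw [show Matrix.single i j (z i j) = z i j • Matrix.single i j (1 : ℂ) by simp, map_smul,
      hs.smul_left]
    rfl
  refine ⟨y, ?_, ?_, hy⟩
  · have := hD.conj p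
    rw [Matrix.star_eq_conjTranspose, hp] at this
    simp only [mul_assoc] at this
    exact this
  · refine eq_of_traceForm_eq hq hu fun z => ?_
    rw [hy, hone, traceForm, mul_one]
    simpa only [mul_assoc] using Matrix.trace_mul_comm (q * q) (q * q * zᴴ)

end Riesz

end

section

open scoped ComplexOrder
open Filter Topology

section States

variable {A B : Type*} [CStarAlgebra A] [PartialOrder A] [StarOrderedRing A]
  [CStarAlgebra B] [PartialOrder B] [StarOrderedRing B]
  {I : Type*} {U : Ultrafilter I} {N : I → MatrixFactorization A}

lemma IsHermForm.norm_le_mul {s : A → A → ℂ} {g : A →ₗ[ℂ] ℂ} (hg : IsPosFun g) (h1 : g 1 = 1)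
    (hs : ∀ x y, ‖s x y‖ ^ 2 ≤ (g (x * star x)).re * (g (star y * y)).re) (x y : A) :
    ‖s x y‖ ≤ ‖x‖ * ‖y‖ := by
  refine le_of_sq_le_sq ((hs x y).trans ?_) (by positivity)
  rw [mul_pow]
  have e1 := hg.re_star_mul_self_le (star x)
  have e2 := hg.re_star_mul_self_le y
  rw [star_star, norm_star, h1, Complex.one_re, one_mul] at e1
  rw [h1, Complex.one_re, one_mul] at e2
  exact mul_le_mul e1 e2 (hg.re_nonneg y) (by positivity)

/-- A form on `A` controlled by a state of a quotient `B` descends to `B`. -/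
lemma exists_descended_form {π : A →⋆ₐ[ℂ] B} (hπ : Function.Surjective π) {f : B →ₗ[ℂ] ℂ}
    {s : A → A → ℂ} (hs : IsHermForm s)
    (hb : ∀ x y, ‖s x y‖ ^ 2 ≤ (f (π (x * star x))).re * (f (π (star y * y))).re) :
    ∃ t : B → B → ℂ, IsHermForm t ∧ ∀ x y, s x y = t (π x) (π y) := by
  have h0 : ∀ x y, π x = 0 → s x y = 0 := by
    intro x y hx
    have := hb x y
    rw [map_mul, hx, zero_mul, map_zero, Complex.zero_re, zero_mul] at this
    exact norm_eq_zero.1 (pow_eq_zero_iff two_ne_zero |>.1 (le_antisymm this (sq_nonneg _)))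
  have h0' : ∀ x y, π y = 0 → s x y = 0 := fun x y hy => by
    rw [← hs.conj_symm, h0 y x hy, star_zero]
  have hwd : ∀ x x' y y', π x = π x' → π y = π y' → s x y = s x' y' := by
    intro x x' y y' hx hy
    have e1 := h0 (x - x') y (by rw [map_sub, hx, sub_self])
    have e2 := h0' x' (y - y') (by rw [map_sub, hy, sub_self])
    rw [hs.sub_left, sub_eq_zero] at e1
    rw [hs.sub_right, sub_eq_zero] at e2
    exact e1.trans e2
  have hinv := Function.surjInv_eq hπ
  refine ⟨fun x y => s (Function.surjInv hπ x) (Function.surjInv hπ y), ⟨fun x y z => ?_,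
    fun c x y => ?_, fun x y => hs.conj_symm _ _⟩, fun x y => hwd _ _ _ _ (hinv _).symm
    (hinv _).symm⟩
  · rw [← hs.add_right]
    exact hwd _ _ _ _ rfl (by simp [hinv])
  · rw [← hs.smul_right]
    exact hwd _ _ _ _ rfl (by simp [hinv])

/-- Along approximate factorisations of `A`, a state on a quotient `B` of `A` has contractive
completely positive approximate lifts which are tested by the functionals it dominates. -/
lemma exists_lifts_of_state {π : A →⋆ₐ[ℂ] B} (hπ : Function.Surjective π)
    (hN : ∀ x, Tendsto (fun i => (N i).ψ ((N i).φ x)) U (𝓝 x))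
    {f : B →ₗ[ℂ] ℂ} (hf : IsPosFun f) (hf1 : f 1 = 1) :
    ∃ θ : I → B →ₗ[ℂ] A, (∀ i, IsFamilyCP (θ i) ∧ θ i 1 ≤ 1) ∧
      ∀ ω : B →ₗ[ℂ] ℂ, IsPosFun ω → IsPosFun (f - ω) →
        ∀ b, Tendsto (fun i => ω (π (θ i b))) U (𝓝 (ω b)) := by
  let πl : A →ₗ[ℂ] B := π.toAlgHom.toLinearMap
  let g : A →ₗ[ℂ] ℂ := f ∘ₗ πl
  have hgf : ∀ x, g x = f (π x) := fun x => rfl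
  have hg : IsPosFun g := fun x => by
    rw [hgf, map_mul, map_star]
    exact hf _
  have hg1 : g 1 = 1 := by rw [hgf, map_one, hf1]
  choose q hq hu hqg using fun i => (N i).exists_density hg hg1
  obtain ⟨s, hs, hs0, hslim, hsb, hs1, hsstar, hsgram⟩ := exists_limit_form hN hg q hq hqg
  have hsn := IsHermForm.norm_le_mul hg hg1 hsb
  obtain ⟨t, ht, hst⟩ := exists_descended_form hπ hs hsb
  have hr : ∀ i, (q i * q i).IsHermitian := fun i => by
    rw [Matrix.IsHermitian, Matrix.conjTranspose_mul, (hq i).eq]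
  have hπcp : IsFamilyCP πl := IsFamilyCP.of_starHom π
  have htstar : ∀ x y, t (star x) (star y) = star (t x y) := by
    intro x y
    obtain ⟨x, rfl⟩ := hπ x
    obtain ⟨y, rfl⟩ := hπ y
    rw [← map_star, ← map_star, ← hst, ← hst, hsstar]
  have htgram : ∀ (n : ℕ) (c b : Fin n → B),
      0 ≤ (∑ p, ∑ r, t (star (c p) * c r) (star (b p) * b r)).re := by
    intro n c b
    choose c' hc using fun p => hπ (c p)
    choose b' hb using fun p => hπ (b p)
    simpa only [hst, map_mul, map_star, hc, hb] using hsgram n c' b'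
  have hy : ∀ i, ∃ y : B →ₗ[ℂ] Matrix (N i).ι (N i).ι ℂ, IsFamilyCP y ∧ y 1 = 1 ∧
      ∀ z b, traceForm (q i * q i) z (y b) = t (π ((N i).ψ z)) b := fun i =>
    exists_riesz_matrix (T := πl ∘ₗ (N i).ψ) ht htstar htgram
      (hπcp.comp (map_add πl) (N i).ψ_cp) (hq i) (hu i) fun z => by
        rw [← hqg, ← Matrix.star_eq_conjTranspose, (N i).ψ_cp.map_star, ← hs1, hst, map_one]
        rfl
  choose y hycp hy1 hyt using hy
  let θ : I → B →ₗ[ℂ] A := fun i => (N i).ψ ∘ₗ y i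
  have hθ : ∀ i b, θ i b = (N i).ψ (y i b) := fun i b => rfl
  have hθcp : ∀ i, IsFamilyCP (θ i) := fun i => (N i).ψ_cp.comp (map_add _) (hycp i)
  have hθ1 : ∀ i, θ i 1 ≤ 1 := fun i => by rw [hθ, hy1]; exact (N i).ψ_one
  have hθn : ∀ i b, ‖θ i b‖ ≤ ‖b‖ := fun i b => (hθcp i).norm_map_le (hθ1 i) b
  have hπn : ∀ x, ‖π x‖ ≤ ‖x‖ := fun x => NonUnitalStarAlgHom.norm_apply_le π x
  -- bounds for traces of products
  have htr : ∀ i (z : Matrix (N i).ι (N i).ι ℂ), (g (star ((N i).ψ z) * (N i).ψ z)).re ≤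
      (q i * q i * (q i * q i) * (z.conjTranspose * z)).trace.re := fun i z => by
    rw [← hqg]; exact (N i).re_star_mul_map_le hg z
  have htr' : ∀ i (z : Matrix (N i).ι (N i).ι ℂ), (g ((N i).ψ z * star ((N i).ψ z))).re ≤
      (q i * q i * (q i * q i) * (z * z.conjTranspose)).trace.re := fun i z => by
    have := htr i z.conjTranspose
    rwa [← Matrix.star_eq_conjTranspose, (N i).ψ_cp.map_star, star_star,
      Matrix.star_eq_conjTranspose, Matrix.conjTranspose_conjTranspose] at this
  have hg0 : ∀ x, 0 ≤ (g (x * star x)).re := fun x => by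
    have := hg.re_nonneg (star x); rwa [star_star] at this
  have hdom : ∀ i z, (s ((N i).ψ z) ((N i).ψ z)).re ≤ (traceForm (q i * q i) z z).re := by
    intro i
    refine (hs.comp (N i).ψ).re_le_traceForm (hq i) (hu i) fun z w => (hsb _ _).trans ?_
    exact mul_le_mul (htr' i z) (htr i w) (hg.re_nonneg _) ((hg0 _).trans (htr' i z))
  -- convergence of the defect form
  have hψφ : ∀ a, Tendsto (fun i => s ((N i).ψ ((N i).φ a)) ((N i).ψ ((N i).φ a))) U
      (𝓝 (s a a)) := by
    intro a
    have h1 := tendsto_iff_norm_sub_tendsto_zero.1 (hN a)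
    have h2 : Tendsto (fun i => ‖(N i).ψ ((N i).φ a) - a‖ * (‖(N i).ψ ((N i).φ a)‖ + ‖a‖)) U
        (𝓝 0) := by
      simpa using h1.mul ((hN a).norm.add_const ‖a‖)
    refine tendsto_iff_norm_sub_tendsto_zero.2 (squeeze_zero (fun _ => norm_nonneg _)
      (fun i => ?_) h2)
    set x := (N i).ψ ((N i).φ a)
    have e : s x x - s a a = s (x - a) x + s a (x - a) := by
      rw [hs.sub_left, hs.sub_right]; ring
    rw [e]
    refine (norm_add_le _ _).trans ?_
    have e1 := hsn (x - a) x
    have e2 := hsn a (x - a)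
    linarith
  have hdefect : ∀ a, Tendsto (fun i => (traceForm (q i * q i) ((N i).φ a) ((N i).φ a) -
      s ((N i).ψ ((N i).φ a)) ((N i).ψ ((N i).φ a))).re) U (𝓝 0) := fun a => by
    have h := (Complex.continuous_re.tendsto _).comp ((hslim a a).sub (hψφ a))
    rwa [sub_self, Complex.zero_re] at h
  have hconv : ∀ a b, Tendsto (fun i => t (π a) (π (θ i b))) U (𝓝 (t (π a) b)) := by
    intro a b
    obtain ⟨c, rfl⟩ := hπ b
    simp only [← hst]
    have h1 := tendsto_iff_norm_sub_tendsto_zero.1 (hN a)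
    have h2 : Tendsto (fun i => ‖(N i).ψ ((N i).φ a) - a‖ * ‖c‖ +
        √((traceForm (q i * q i) ((N i).φ a) ((N i).φ a) -
          s ((N i).ψ ((N i).φ a)) ((N i).ψ ((N i).φ a))).re * (‖π c‖ * ‖c‖)) +
        ‖(N i).ψ ((N i).φ a) - a‖ * ‖π c‖) U (𝓝 0) := by
      have e := ((Real.continuous_sqrt.tendsto _).comp ((hdefect a).mul_const (‖π c‖ * ‖c‖)))
      simpa using ((h1.mul_const ‖c‖).add e).add (h1.mul_const ‖π c‖)
    refine tendsto_iff_norm_sub_tendsto_zero.2 (squeeze_zero (fun _ => norm_nonneg _)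
      (fun i => ?_) h2)
    set x := (N i).ψ ((N i).φ a) with hx
    let d : Matrix (N i).ι (N i).ι ℂ → Matrix (N i).ι (N i).ι ℂ → ℂ := fun z w =>
      traceForm (q i * q i) z w - s ((N i).ψ z) ((N i).ψ w)
    have hd : IsHermForm d := (isHermForm_traceForm (hr i)).sub (hs.comp (N i).ψ)
    have hd0 : ∀ z, 0 ≤ (d z z).re := fun z => by
      have := hdom i z
      simp only [d, Complex.sub_re]
      linarith
    have e : s a (θ i (π c)) - s a c = s (x - a) c - d ((N i).φ a) (y i (π c)) -
        s (x - a) (θ i (π c)) := by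
      simp only [d, hyt, ← hst, ← hθ]
      rw [← hx, hs.sub_left, hs.sub_left]
      ring
    have e1 := hsn (x - a) c
    have e2 : ‖d ((N i).φ a) (y i (π c))‖ ≤ √((d ((N i).φ a) ((N i).φ a)).re * (‖π c‖ * ‖c‖)) := by
      refine Real.le_sqrt_of_sq_le ((hd.norm_sq_le hd0 _ _).trans ?_)
      refine mul_le_mul_of_nonneg_left ?_ (hd0 _)
      have e3 : (d (y i (π c)) (y i (π c))).re ≤ (s (θ i (π c)) c).re := by
        have := hs0 (θ i (π c))
        simp only [d, hyt, ← hst, ← hθ, Complex.sub_re]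
        linarith
      refine e3.trans ((Complex.re_le_norm _).trans ((hsn _ _).trans ?_))
      exact mul_le_mul_of_nonneg_right (hθn i _) (norm_nonneg _)
    have e3 := (hsn (x - a) (θ i (π c))).trans
      (mul_le_mul_of_nonneg_left (hθn i (π c)) (norm_nonneg _))
    rw [e]
    refine (norm_sub_le _ _).trans (add_le_add ((norm_sub_le _ _).trans (add_le_add e1 e2)) e3)
  refine ⟨θ, fun i => ⟨hθcp i, hθ1 i⟩, fun ω hω hfω b => ?_⟩
  have hω1 : (ω 1).re ≤ 1 := by
    have := hfω.re_one_nonneg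
    rw [LinearMap.sub_apply, hf1, Complex.sub_re, Complex.one_re] at this
    linarith
  have hωf : ∀ x, (ω (star x * x)).re ≤ (f (star x * x)).re := fun x => by
    have := hfω.re_nonneg x
    rw [LinearMap.sub_apply, Complex.sub_re] at this
    linarith
  have hω2 : ∀ x, ‖ω x‖ ^ 2 ≤ (f (star x * x)).re := fun x =>
    (hω.norm_sq_le x).trans (by nlinarith [hωf x, hω.re_nonneg x, hω.re_one_nonneg])
  have hω2' : ∀ x, ‖ω x‖ ^ 2 ≤ (f (x * star x)).re := fun x => by
    have := hω2 (star x)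
    rwa [star_star, hω.map_star, norm_star] at this
  have hωs : ∀ a, ‖ω (π a)‖ ^ 2 ≤ 1 * (s a a).re := by
    intro a
    rw [one_mul]
    have hc : Tendsto (fun i => ‖ω (π ((N i).ψ ((N i).φ a)))‖ ^ 2) U (𝓝 (‖ω (π a)‖ ^ 2)) := by
      have hπc : Continuous π := AddMonoidHomClass.continuous_of_bound π 1 fun x => by
        simpa using hπn x
      exact ((((hω.continuous.comp hπc).tendsto a).comp (hN a)).norm).pow 2
    refine le_of_tendsto_of_tendsto' hc ((Complex.continuous_re.tendsto _).comp (hslim a a))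
      fun i => ?_
    let ρ : Matrix (N i).ι (N i).ι ℂ →ₗ[ℂ] ℂ := ω ∘ₗ πl ∘ₗ (N i).ψ
    have hρ : ∀ z, ρ z = ω (π ((N i).ψ z)) := fun z => rfl
    have hγ : IsHermForm fun z w => star (ρ z) * ρ w :=
      ⟨fun x y z => by rw [map_add, mul_add], fun t x y => by
        rw [map_smul, smul_eq_mul]; ring, fun x y => by rw [star_mul', star_star, mul_comm]⟩
    have h := hγ.re_le_traceForm (hq i) (hu i) (fun z w => ?_) ((N i).φ a)
    · have e : (star (ρ ((N i).φ a)) * ρ ((N i).φ a)).re = ‖ρ ((N i).φ a)‖ ^ 2 := by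
        rw [Complex.star_def, Complex.conj_mul', ← Complex.ofReal_pow, Complex.ofReal_re]
      rwa [e] at h
    · rw [norm_mul, norm_star, mul_pow]
      refine mul_le_mul (le_trans ?_ (htr' i z)) (le_trans ?_ (htr i w)) (sq_nonneg _)
        ((hg0 _).trans (htr' i z))
      · rw [hρ, hgf, map_mul, map_star]; exact hω2' _
      · rw [hρ, hgf, map_mul, map_star]; exact hω2 _
  have ht0 : ∀ x, 0 ≤ (t x x).re := fun x => by
    obtain ⟨a, rfl⟩ := hπ x
    rw [← hst]; exact hs0 a
  have hωt : ∀ x, ‖ω x‖ ^ 2 ≤ 1 * (t x x).re := fun x => by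
    obtain ⟨a, rfl⟩ := hπ x
    rw [← hst]; exact hωs a
  have htn : ∀ x, (t x x).re ≤ ‖x‖ ^ 2 := fun x => by
    rw [sq]
    refine (Complex.re_le_norm _).trans (IsHermForm.norm_le_mul hf hf1 (fun x y => ?_) x x)
    obtain ⟨a, rfl⟩ := hπ x
    obtain ⟨b, rfl⟩ := hπ y
    rw [← hst]
    simpa only [hgf, map_mul, map_star] using hsb a b
  rw [Metric.tendsto_nhds]
  intro ε hε
  have hη : 0 < (ε / 2) ^ 2 / (4 * ‖b‖ ^ 2 + 1) := by positivity
  obtain ⟨c, hc⟩ := ht.exists_norm_sq_sub_le ht0 ω hωt hη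
  obtain ⟨a, rfl⟩ := hπ c
  filter_upwards [Metric.tendsto_nhds.1 (hconv a b) (ε / 2) (half_pos hε)] with i hi
  rw [dist_eq_norm] at hi ⊢
  rw [← ht.sub_right] at hi
  rw [← map_sub]
  set w := π (θ i b) - b
  have hw : ‖w‖ ^ 2 ≤ 4 * ‖b‖ ^ 2 := by
    have h1 : ‖w‖ ≤ 2 * ‖b‖ := by
      refine (norm_sub_le _ _).trans ?_
      have := (hπn (θ i b)).trans (hθn i b)
      linarith
    nlinarith [norm_nonneg w, norm_nonneg b]
  have h1 : ‖ω w - t (π a) w‖ ≤ ε / 2 := by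
    refine le_of_sq_le_sq ((hc w).trans ?_) (by positivity)
    rw [div_mul_eq_mul_div, div_le_iff₀ (by positivity)]
    refine mul_le_mul_of_nonneg_left ?_ (sq_nonneg _)
    linarith [htn w]
  have h2 : ‖ω w‖ ≤ ‖ω w - t (π a) w‖ + ‖t (π a) w‖ := norm_le_norm_sub_add _ _
  linarith

end States

end

section

open scoped ComplexOrder
open Filter Topology

section Jordan

variable {B : Type*} [CStarAlgebra B] [PartialOrder B] [StarOrderedRing B]

lemma norm_le_of_nonneg_of_le_smul_one {h : B} {t : ℝ} (ht : 0 ≤ t) (h0 : 0 ≤ h)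
    (h1 : h ≤ t • (1 : B)) : ‖h‖ ≤ t := by
  rw [CStarAlgebra.norm_le_iff_le_algebraMap h ht h0, Algebra.algebraMap_eq_smul_one]
  exact h1

lemma exists_real_jordan [Nontrivial B] (ρ : B →ₗ[ℝ] ℝ) {C : ℝ} (hρ : ∀ x, |ρ x| ≤ C * ‖x‖)
    (hstar : ∀ x, ρ (star x) = ρ x) :
    ∃ g₁ g₂ : B →ₗ[ℝ] ℝ, (∀ x, 0 ≤ x + star x → 0 ≤ g₁ x) ∧ (∀ x, 0 ≤ x + star x → 0 ≤ g₂ x) ∧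
      ∀ x, ρ x = g₁ x - g₂ x := by
  have hC : 0 ≤ C := by
    have := (abs_nonneg _).trans (hρ 1)
    rwa [CStarRing.norm_one, mul_one] at this
  obtain ⟨τ, hτ⟩ := SeparatingDual.exists_eq_one (R := ℝ) (one_ne_zero (α := B))
  let K : PointedCone ℝ (B × B) :=
    { carrier := {y | 0 ≤ y.1 + star y.1 ∧ 0 ≤ y.2 + star y.2}
      add_mem' := by
        rintro x y ⟨h1, h2⟩ ⟨h3, h4⟩
        constructor
        · have := add_nonneg h1 h3
          simpa only [Prod.fst_add, star_add, add_add_add_comm] using this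
        · have := add_nonneg h2 h4
          simpa only [Prod.snd_add, star_add, add_add_add_comm] using this
      zero_mem' := by simp
      smul_mem' := by
        rintro ⟨c, hc⟩ x ⟨h1, h2⟩
        constructor
        · have : 0 ≤ c • (x.1 + star x.1) := smul_nonneg hc h1
          change 0 ≤ c • x.1 + star (c • x.1)
          simpa only [smul_add, star_smul, star_trivial] using this
        · have : 0 ≤ c • (x.2 + star x.2) := smul_nonneg hc h2
          change 0 ≤ c • x.2 + star (c • x.2)
          simpa only [smul_add, star_smul, star_trivial] using this }
  let p : Submodule ℝ (B × B) :=
    { carrier := {y | ∃ t : ℝ, y.1 + y.2 = t • (1 : B)}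
      add_mem' := by
        rintro x y ⟨t, ht⟩ ⟨r, hr⟩
        exact ⟨t + r, by rw [add_smul, ← ht, ← hr, Prod.fst_add, Prod.snd_add]; abel⟩
      zero_mem' := ⟨0, by simp⟩
      smul_mem' := by
        rintro c x ⟨t, ht⟩
        exact ⟨c * t, by rw [mul_smul, ← ht, smul_add]; rfl⟩ }
  let F : B × B →ₗ[ℝ] ℝ := (ρ ∘ₗ (LinearMap.fst ℝ B B - LinearMap.snd ℝ B B)) +
    (3 * C) • ((τ : B →ₗ[ℝ] ℝ) ∘ₗ (LinearMap.fst ℝ B B + LinearMap.snd ℝ B B))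
  have hF : ∀ u v, F (u, v) = ρ (u - v) + 3 * C * τ (u + v) := fun u v => rfl
  obtain ⟨g, hg, hgK⟩ := riesz_extension K ⟨p, F.domRestrict p⟩ (by
    rintro ⟨⟨u, v⟩, t, ht⟩ ⟨h1, h2⟩
    change 0 ≤ F (u, v)
    change u + v = t • (1 : B) at ht
    change 0 ≤ u + star u at h1
    change 0 ≤ v + star v at h2
    have hle : u + star u ≤ (2 * t) • (1 : B) := by
      have e : v + star v = (2 * t) • (1 : B) - (u + star u) := by
        have h3 : v = t • (1 : B) - u := by rw [← ht]; abel
        rw [h3, star_sub, star_smul, star_one, star_trivial, two_mul, add_smul]; abel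
      rw [e] at h2
      exact sub_nonneg.1 h2
    have ht0 : 0 ≤ t := by
      by_contra! hneg
      have h3 := h1.trans hle
      have h4 : (0 : B) ≤ (-(2 * t)) • (1 : B) := smul_nonneg (by linarith) zero_le_one
      rw [neg_smul] at h4
      have h5 : (2 * t) • (1 : B) = 0 := le_antisymm (neg_nonneg.1 h4) h3
      rcases smul_eq_zero.1 h5 with h6 | h6
      · linarith
      · exact one_ne_zero h6
    have hn := norm_le_of_nonneg_of_le_smul_one (by linarith) h1 hle
    have e : ρ (u - v) = ρ (u + star u - t • (1 : B)) := by
      have h3 : v = t • (1 : B) - u := by rw [← ht]; abel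
      have h4 : ρ (u + star u) = 2 * ρ u := by rw [map_add, hstar]; ring
      rw [map_sub, map_sub, h4, h3, map_sub]; ring
    have hb := hρ (u + star u - t • (1 : B))
    have hn2 : ‖u + star u - t • (1 : B)‖ ≤ 3 * t := by
      refine (norm_sub_le _ _).trans ?_
      rw [norm_smul, CStarRing.norm_one, Real.norm_of_nonneg ht0]
      linarith
    rw [hF, e, ht, map_smul, hτ]
    have hb' := (abs_le.1 (hb.trans (mul_le_mul_of_nonneg_left hn2 hC))).1
    simp only [smul_eq_mul, mul_one]
    linarith)
    (by
      rintro ⟨u, v⟩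
      have key : ∀ w : B, ∀ r : ℝ, ‖w + star w‖ ≤ 2 * r → 0 ≤ (r • (1 : B) + w) +
          star (r • (1 : B) + w) := by
        intro w r hr
        have h1 := (IsSelfAdjoint.add_star_self w).neg_algebraMap_norm_le_self
        rw [Algebra.algebraMap_eq_smul_one] at h1
        have h2 : (0 : B) ≤ (2 * r - ‖w + star w‖) • (1 : B) :=
          smul_nonneg (by linarith) zero_le_one
        have h3 := add_nonneg h2 (neg_le_iff_add_nonneg'.1 h1)
        convert h3 using 1
        rw [star_add, star_smul, star_one, star_trivial, sub_smul, two_mul, add_smul]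
        abel
      let r := (‖u + star u‖ + ‖v + star v‖) / 2
      refine ⟨⟨(r • 1, r • 1), r + r, by rw [add_smul]⟩, key u r ?_, key v r ?_⟩
      · have := norm_nonneg (v + star v)
        simp only [r]; linarith
      · have := norm_nonneg (u + star u)
        simp only [r]; linarith)
  refine ⟨(2⁻¹ : ℝ) • (g ∘ₗ LinearMap.inl ℝ B B), (2⁻¹ : ℝ) • (g ∘ₗ LinearMap.inr ℝ B B),
    fun x hx => ?_, fun x hx => ?_, fun x => ?_⟩
  · have : 0 ≤ g (x, 0) := hgK _ ⟨hx, by simp⟩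
    simpa using this
  · have : 0 ≤ g (0, x) := hgK _ ⟨by simp, hx⟩
    simpa using this
  · have h1 : g (x, -x) = F (x, -x) := hg ⟨(x, -x), 0, by simp⟩
    rw [hF, add_neg_cancel, map_zero, mul_zero, add_zero, sub_neg_eq_add, map_add] at h1
    have h2 : g (x, -x) = g (x, 0) - g (0, x) := by rw [← map_sub]; simp
    simp only [LinearMap.smul_apply, LinearMap.comp_apply, LinearMap.inl_apply,
      LinearMap.inr_apply, smul_eq_mul]
    linarith

lemma isPosFun_extendRCLike {g : B →ₗ[ℝ] ℝ} (hg : ∀ x, 0 ≤ x + star x → 0 ≤ g x) :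
    IsPosFun (X := B) (Module.Dual.extendRCLike (𝕜 := ℂ) g) := by
  intro x
  have h1 : 0 ≤ g (star x * x) := hg _ (by
    rw [star_mul, star_star]
    exact add_nonneg (star_mul_self_nonneg x) (star_mul_self_nonneg x))
  have h3 : ((Complex.I • (star x * x)) + star (Complex.I • (star x * x)) : B) = 0 := by
    rw [star_smul, star_mul, star_star, ← add_smul]
    simp
  have h2 : g (Complex.I • (star x * x)) = 0 := by
    refine le_antisymm ?_ (hg _ h3.ge)
    have := hg (-(Complex.I • (star x * x))) (by rw [star_neg, ← neg_add, h3, neg_zero])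
    rwa [map_neg, neg_nonneg] at this
  rw [Module.Dual.extendRCLike_apply]
  simp only [RCLike.I_to_complex, h2]
  simpa using h1

lemma exists_jordan_hermitian [Nontrivial B] (ϕ : B →ₗ[ℂ] ℂ) {C : ℝ} (hϕ : ∀ x, ‖ϕ x‖ ≤ C * ‖x‖) :
    ∃ f₁ f₂ : B →ₗ[ℂ] ℂ, IsPosFun f₁ ∧ IsPosFun f₂ ∧
      ∀ x, f₁ x - f₂ x = ϕ x + star (ϕ (star x)) := by
  let ρ : B →ₗ[ℝ] ℝ :=
    { toFun := fun x => (ϕ x + star (ϕ (star x))).re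
      map_add' := fun x y => by simp only [map_add, star_add, Complex.add_re]; ring
      map_smul' := fun c x => by
        rw [RCLike.real_smul_eq_coe_smul (K := ℂ) c x]
        simp [mul_add] }
  have hρ : ∀ x, ρ x = (ϕ x + star (ϕ (star x))).re := fun _ => rfl
  obtain ⟨g₁, g₂, h1, h2, h⟩ := exists_real_jordan ρ (C := C + C) (fun x => by
    rw [hρ]
    refine (Complex.abs_re_le_norm _).trans ((norm_add_le _ _).trans ?_)
    have e1 := hϕ x
    have e2 := hϕ (star x)
    rw [norm_star] at e2 ⊢
    linarith) (fun x => by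
      rw [hρ, hρ, star_star]
      simp [add_comm])
  refine ⟨_, _, isPosFun_extendRCLike h1, isPosFun_extendRCLike h2, fun x => ?_⟩
  have e1 := h x
  have e2 := h (Complex.I • x)
  rw [hρ] at e1 e2
  apply Complex.ext
  · rw [e1, Complex.sub_re]
    simp [Module.Dual.extendRCLike_apply]
  · simp [Module.Dual.extendRCLike_apply] at e2 ⊢
    linarith

/-- Bounded functionals are combinations of positive ones. -/
lemma mem_span_isPosFun [Nontrivial B] (ϕ : B →ₗ[ℂ] ℂ) {C : ℝ} (hϕ : ∀ x, ‖ϕ x‖ ≤ C * ‖x‖) :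
    ϕ ∈ Submodule.span ℂ {f : B →ₗ[ℂ] ℂ | IsPosFun f} := by
  obtain ⟨f₁, f₂, h1, h2, h⟩ := exists_jordan_hermitian ϕ hϕ
  obtain ⟨f₃, f₄, h3, h4, h'⟩ := exists_jordan_hermitian (Complex.I • ϕ) (C := C) (fun x => by
    simpa using hϕ x)
  have e : ϕ = (2⁻¹ : ℂ) • ((f₁ - f₂) - Complex.I • (f₃ - f₄)) := by
    ext x
    simp only [LinearMap.smul_apply, LinearMap.sub_apply, h, h', smul_eq_mul, star_mul',
      Complex.star_def, Complex.conj_I]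
    linear_combination (1 / 2 * (ϕ x) - 1 / 2 * (starRingEnd ℂ) (ϕ (star x))) * Complex.I_sq
  rw [e]
  exact Submodule.smul_mem _ _ (Submodule.sub_mem _ (Submodule.sub_mem _
    (Submodule.subset_span h1) (Submodule.subset_span h2)) (Submodule.smul_mem _ _
    (Submodule.sub_mem _ (Submodule.subset_span h3) (Submodule.subset_span h4))))

end Jordan

end

section

open scoped ComplexOrder
open Filter Topology

section ApproxLift

variable {A B : Type*} [CStarAlgebra A] [CStarAlgebra B]

namespace IsPosFun

variable {B : Type*} [CStarAlgebra B] {f g : B →ₗ[ℂ] ℂ}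

lemma add (hf : IsPosFun f) (hg : IsPosFun g) : IsPosFun (f + g) := fun x =>
  add_nonneg (hf x) (hg x)

lemma zero : IsPosFun (0 : B →ₗ[ℂ] ℂ) := fun _ => le_rfl

lemma smul (hf : IsPosFun f) {t : ℝ} (ht : 0 ≤ t) : IsPosFun ((t : ℂ) • f) := fun x =>
  mul_nonneg (by exact_mod_cast ht) (hf x)

lemma sum {κ : Type*} {s : Finset κ} {F : κ → B →ₗ[ℂ] ℂ} (h : ∀ k ∈ s, IsPosFun (F k)) :
    IsPosFun (∑ k ∈ s, F k) := fun x => by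
  rw [LinearMap.sum_apply]
  exact Finset.sum_nonneg fun k hk => h k hk x

end IsPosFun

lemma exists_isPosFun_dominating {ϕ : B →ₗ[ℂ] ℂ}
    (hϕ : ϕ ∈ Submodule.span ℂ {f : B →ₗ[ℂ] ℂ | IsPosFun f}) :
    ∃ g, IsPosFun g ∧ ∀ h : B →ₗ[ℂ] ℂ, IsPosFun (h - g) →
      ϕ ∈ Submodule.span ℂ {ω : B →ₗ[ℂ] ℂ | IsPosFun ω ∧ IsPosFun (h - ω)} := by
  induction hϕ using Submodule.span_induction with
  | mem x hx => exact ⟨x, hx, fun h hh => Submodule.subset_span ⟨hx, hh⟩⟩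
  | zero => exact ⟨0, IsPosFun.zero, fun h _ => Submodule.zero_mem _⟩
  | add x y _ _ ihx ihy =>
    obtain ⟨g, hg, hg'⟩ := ihx
    obtain ⟨k, hk, hk'⟩ := ihy
    refine ⟨g + k, hg.add hk, fun h hh => Submodule.add_mem _ (hg' h ?_) (hk' h ?_)⟩
    · convert hh.add hk using 1; abel
    · convert hh.add hg using 1; abel
  | smul a x _ ih =>
    obtain ⟨g, hg, hg'⟩ := ih
    exact ⟨g, hg, fun h hh => Submodule.smul_mem _ _ (hg' h hh)⟩

/-- A C*-algebra is approximately factorable if its identity is approximated by unital completely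
positive maps into matrix algebras followed by contractive ones back. -/
def ApproxFactorable (A : Type*) [CStarAlgebra A] [PartialOrder A] : Prop :=
  ∀ (F : Finset A) (ε : ℝ), 0 < ε → ∃ N : MatrixFactorization A, ∀ x ∈ F, ‖N.ψ (N.φ x) - x‖ < ε

lemma ApproxFactorable.exists_ultrafilter [PartialOrder A] (hA : ApproxFactorable A) :
    ∃ (U : Ultrafilter (Finset A × ℕ)) (N : Finset A × ℕ → MatrixFactorization A),
      ∀ x, Tendsto (fun i => (N i).ψ ((N i).φ x)) U (𝓝 x) := by
  choose N hN using fun i : Finset A × ℕ => hA i.1 (1 / ((i.2 : ℝ) + 1)) (by positivity)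
  classical
  refine ⟨Ultrafilter.of atTop, N, fun x => Tendsto.mono_left ?_ (Ultrafilter.of_le _)⟩
  rw [Metric.tendsto_nhds]
  intro ε hε
  obtain ⟨n, hn⟩ := exists_nat_one_div_lt hε
  filter_upwards [eventually_ge_atTop (({x} : Finset A), n)] with i hi
  rw [dist_eq_norm]
  refine (hN i x (hi.1 (Finset.mem_singleton_self x))).trans (lt_of_le_of_lt ?_ hn)
  have : (n : ℝ) ≤ i.2 := by exact_mod_cast hi.2
  gcongr

variable [PartialOrder A] [StarOrderedRing A] [PartialOrder B] [StarOrderedRing B]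

lemma exists_isPosFun_one_pos [Nontrivial B] : ∃ f : B →ₗ[ℂ] ℂ, IsPosFun f ∧ 0 < (f 1).re := by
  by_contra! hne
  obtain ⟨τ, hτ⟩ := SeparatingDual.exists_eq_one (R := ℂ) (one_ne_zero (α := B))
  have h := mem_span_isPosFun (τ : B →ₗ[ℂ] ℂ) (C := ‖τ‖) τ.le_opNorm
  have h0 : ∀ ϕ ∈ Submodule.span ℂ {f : B →ₗ[ℂ] ℂ | IsPosFun f}, ϕ 1 = 0 := by
    intro ϕ hϕ
    induction hϕ using Submodule.span_induction with
    | mem x hx =>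
      rw [IsPosFun.map_one_eq hx, le_antisymm (hne x hx) (IsPosFun.re_one_nonneg hx)]; simp
    | zero => rfl
    | add x y _ _ hx hy => rw [LinearMap.add_apply, hx, hy, add_zero]
    | smul a x _ hx => rw [LinearMap.smul_apply, hx, smul_zero]
  exact one_ne_zero (hτ.symm.trans (h0 _ h))

/-- Finitely many bounded functionals are combinations of functionals dominated by one state. -/
lemma exists_state_dominating [Nontrivial B] {κ : Type*} [Fintype κ] (Λ : κ → B →L[ℂ] ℂ) :
    ∃ f : B →ₗ[ℂ] ℂ, IsPosFun f ∧ f 1 = 1 ∧ ∀ k, (Λ k : B →ₗ[ℂ] ℂ) ∈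
      Submodule.span ℂ {ω : B →ₗ[ℂ] ℂ | IsPosFun ω ∧ IsPosFun (f - ω)} := by
  choose g hg hgd using fun k => exists_isPosFun_dominating
    (mem_span_isPosFun (Λ k : B →ₗ[ℂ] ℂ) (C := ‖Λ k‖) (Λ k).le_opNorm)
  obtain ⟨g₀, hg₀, hpos⟩ := exists_isPosFun_one_pos (B := B)
  let h := g₀ + ∑ k, g k
  have hh : IsPosFun h := hg₀.add (IsPosFun.sum fun k _ => hg k)
  have hsum : 0 ≤ ((∑ k, g k) 1).re := (IsPosFun.sum fun k _ => hg k).re_one_nonneg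
  have h1 : 0 < (h 1).re := by
    rw [LinearMap.add_apply, Complex.add_re]; linarith
  have h1c : ((h 1).re : ℂ) ≠ 0 := by exact_mod_cast h1.ne'
  have hinv : 0 ≤ (h 1).re⁻¹ := inv_nonneg.2 h1.le
  refine ⟨(((h 1).re⁻¹ : ℝ) : ℂ) • h, hh.smul hinv, ?_, fun k => ?_⟩
  · rw [LinearMap.smul_apply, smul_eq_mul, hh.map_one_eq, Complex.ofReal_re, Complex.ofReal_inv]
    exact inv_mul_cancel₀ h1c
  · have hk : IsPosFun (h - g k) := by
      classical
      have e : h - g k = g₀ + ∑ j ∈ Finset.univ.erase k, g j := by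
        simp only [h]
        rw [← Finset.add_sum_erase _ _ (Finset.mem_univ k)]; abel
      rw [e]
      exact hg₀.add (IsPosFun.sum fun k _ => hg k)
    refine Submodule.span_le.2 ?_ (hgd k h hk)
    rintro ω ⟨hω, hhω⟩
    have e : ω = ((h 1).re : ℂ) • ((((h 1).re⁻¹ : ℝ) : ℂ) • ω) := by
      rw [smul_smul, Complex.ofReal_inv, mul_inv_cancel₀ h1c, one_smul]
    rw [SetLike.mem_coe, e]
    refine Submodule.smul_mem _ _ (Submodule.subset_span ⟨hω.smul hinv, ?_⟩)
    rw [← smul_sub]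
    exact hhω.smul hinv

lemma exists_approx_lift (hA : ApproxFactorable A) {π : A →⋆ₐ[ℂ] B} (hπ : Function.Surjective π)
    (F : Finset B) {ε : ℝ} (hε : 0 < ε) :
    ∃ θ : B →ₗ[ℂ] A, IsFamilyCP θ ∧ θ 1 ≤ 1 ∧ ∀ b ∈ F, ‖π (θ b) - b‖ < ε := by
  rcases subsingleton_or_nontrivial B with hB | hB
  · exact ⟨0, IsFamilyCP.zero, by simp, fun b _ => by
      rw [Subsingleton.elim (π _) b, sub_self, norm_zero]; exact hε⟩
  let t : Set (F → B) := {v | ∃ θ : B →ₗ[ℂ] A, IsFamilyCP θ ∧ θ 1 ≤ 1 ∧ ∀ b, v b = π (θ b)}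
  have ht : Convex ℝ t := by
    rintro v ⟨θ, h1, h2, h3⟩ w ⟨θ', h1', h2', h3'⟩ r r' hr hr' hrr
    refine ⟨(r : ℂ) • θ + (r' : ℂ) • θ', (h1.smul hr).add (h1'.smul hr'), ?_, fun b => ?_⟩
    · have e : ((r : ℂ) • θ + (r' : ℂ) • θ') 1 = r • θ 1 + r' • θ' 1 := rfl
      rw [e]
      refine (add_le_add (smul_le_smul_of_nonneg_left h2 hr)
        (smul_le_smul_of_nonneg_left h2' hr')).trans ?_
      rw [← add_smul, hrr, one_smul]
    · have e : ((r : ℂ) • θ + (r' : ℂ) • θ') b = (r : ℂ) • θ b + (r' : ℂ) • θ' b := rfl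
      rw [e, map_add, map_smul, map_smul, ← h3, ← h3']
      rfl
  by_cases hmem : (fun b : F => (b : B)) ∈ closure t
  · obtain ⟨v, ⟨θ, h1, h2, h3⟩, hv⟩ := Metric.mem_closure_iff.1 hmem ε hε
    refine ⟨θ, h1, h2, fun b hb => ?_⟩
    have := (dist_pi_lt_iff hε).1 hv ⟨b, hb⟩
    rwa [h3, dist_comm, dist_eq_norm] at this
  exfalso
  obtain ⟨Λ, u, hΛ, hu⟩ := RCLike.geometric_hahn_banach_closed_point (𝕜 := ℂ) ht.closure
    isClosed_closure hmem
  classical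
  have hΛs : ∀ v, Λ v = ∑ k, (Λ ∘L ContinuousLinearMap.single ℂ (fun _ : F => B) k) (v k) := by
    intro v
    simp only [ContinuousLinearMap.comp_apply, ← map_sum]
    congr 1
    ext k
    simp [Finset.sum_apply, Pi.single_apply]
  obtain ⟨f, hf, hf1, hspan⟩ := exists_state_dominating
    fun k => Λ ∘L ContinuousLinearMap.single ℂ (fun _ : F => B) k
  obtain ⟨U, N, hN⟩ := hA.exists_ultrafilter
  obtain ⟨θ, hθ, hlim⟩ := exists_lifts_of_state hπ hN hf hf1
  have hlim' : ∀ ϕ ∈ Submodule.span ℂ {ω : B →ₗ[ℂ] ℂ | IsPosFun ω ∧ IsPosFun (f - ω)}, ∀ b,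
      Tendsto (fun i => ϕ (π (θ i b))) U (𝓝 (ϕ b)) := by
    intro ϕ hϕ b
    induction hϕ using Submodule.span_induction with
    | mem x hx => exact hlim x hx.1 hx.2 b
    | zero => exact tendsto_const_nhds
    | add x y _ _ hx hy => exact hx.add hy
    | smul a x _ hx => exact hx.const_mul a
  have hlimΛ : Tendsto (fun i => Λ fun b : F => π (θ i b)) U (𝓝 (Λ fun b : F => (b : B))) := by
    rw [hΛs]
    simp only [hΛs fun b : F => π (θ _ b)]
    exact tendsto_finsetSum _ fun k _ => hlim' _ (hspan k) k
  have h := le_of_tendsto' ((Complex.continuous_re.tendsto _).comp hlimΛ) fun i =>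
    (hΛ _ (subset_closure ⟨θ i, (hθ i).1, (hθ i).2, fun b => rfl⟩)).le
  exact absurd hu (not_lt.2 h)

end ApproxLift

end

section

open scoped ComplexOrder
open Filter Topology

section ApproximateUnit

variable {A : Type*} [CStarAlgebra A] [PartialOrder A] [StarOrderedRing A]

lemma mul_self_le_of_nonneg_of_le_one {d : A} (h0 : 0 ≤ d) (h1 : d ≤ 1) : d * d ≤ d := by
  have hs : IsSelfAdjoint (CFC.sqrt d) := (CFC.sqrt_nonneg d).isSelfAdjoint
  have h := hs.conjugate_nonneg (sub_nonneg.2 h1)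
  have e : CFC.sqrt d * d * CFC.sqrt d = d * d := by
    calc CFC.sqrt d * d * CFC.sqrt d
        = CFC.sqrt d * (CFC.sqrt d * CFC.sqrt d) * CFC.sqrt d := by
          rw [CFC.sqrt_mul_sqrt_self d h0]
      _ = (CFC.sqrt d * CFC.sqrt d) * (CFC.sqrt d * CFC.sqrt d) := by simp only [mul_assoc]
      _ = d * d := by rw [CFC.sqrt_mul_sqrt_self d h0]
  rwa [mul_sub, sub_mul, mul_one, e, CFC.sqrt_mul_sqrt_self d h0, sub_nonneg] at h

lemma norm_one_sub_le_one {e : A} (h0 : 0 ≤ e) (h1 : e ≤ 1) : ‖1 - e‖ ≤ 1 :=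
  (CStarAlgebra.norm_le_one_iff_of_nonneg (1 - e) (sub_nonneg.2 h1)).2 (sub_le_self 1 h0)

variable {J : Type*} [NonUnitalCStarAlgebra J] [PartialOrder J] [StarOrderedRing J]
  (i : J →⋆ₙₐ[ℂ] A)

lemma NonUnitalStarAlgHom.le_of_le {x y : J} (h : x ≤ y) : i x ≤ i y := by
  obtain ⟨d, hd⟩ := exists_eq_star_mul_self_of_nonneg (sub_nonneg.2 h)
  rw [← sub_nonneg, ← map_sub, hd, map_mul, map_star]
  exact star_mul_self_nonneg _

lemma NonUnitalStarAlgHom.le_one_of_norm_le {x : J} (h0 : 0 ≤ x) (h : ‖x‖ ≤ 1) : i x ≤ 1 := by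
  have h0' : 0 ≤ i x := by simpa using i.le_of_le h0
  exact (CStarAlgebra.norm_le_one_iff_of_nonneg _ h0').1
    ((NonUnitalStarAlgHom.norm_apply_le i x).trans h)

lemma tendsto_posFun_one_sub_mul_mul (hi : ∀ (x : A) (j : J), ∃ k, x * i j = i k)
    {ω : A →ₗ[ℂ] ℂ} (hω : IsPosFun ω) (x : A) :
    Tendsto (fun e : J => ω ((1 - i e) * x * i e)) (CStarAlgebra.approximateUnit J) (𝓝 0) := by
  let S : Set ℝ := {r | ∃ e : J, 0 ≤ e ∧ ‖e‖ < 1 ∧ r = (ω (i e)).re}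
  have hω1 := hω.re_one_nonneg
  have hSne : S.Nonempty := ⟨_, 0, le_rfl, by simp, rfl⟩
  have hSb : BddAbove S := ⟨(ω 1).re, by
    rintro _ ⟨e, h0, h1, rfl⟩
    exact hω.re_mono (i.le_one_of_norm_le h0 h1.le)⟩
  have hS0 : 0 ≤ sSup S := le_csSup hSb ⟨0, le_rfl, by simp, by simp⟩
  have hle : ∀ e : J, 0 ≤ e → ‖e‖ ≤ 1 → (ω (i e)).re ≤ sSup S := by
    intro e h0 h1
    by_contra! hlt
    set c := (ω (i e)).re with hc
    have hc0 : 0 < c := hS0.trans_lt hlt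
    have hr0 : 0 ≤ (sSup S + c) / (2 * c) := by positivity
    have hr1 : (sSup S + c) / (2 * c) < 1 := by
      rw [div_lt_one (by positivity)]; linarith
    have hmem : (sSup S + c) / (2 * c) * c ∈ S := by
      refine ⟨(((sSup S + c) / (2 * c) : ℝ)) • e, smul_nonneg hr0 h0, ?_, ?_⟩
      · rw [norm_smul, Real.norm_of_nonneg hr0]
        nlinarith [norm_nonneg e]
      · rw [RCLike.real_smul_eq_coe_smul (K := ℂ), map_smul, map_smul, smul_eq_mul]
        exact (Complex.re_ofReal_mul _ _).symm
    have h2 := le_csSup hSb hmem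
    have h3 : (sSup S + c) / (2 * c) * c = (sSup S + c) / 2 := by field_simp
    rw [h3] at h2
    linarith
  rw [Metric.tendsto_nhds]
  intro ε hε
  let K := (ω 1).re * ‖x‖ ^ 2
  have hK : 0 ≤ K := by positivity
  have hη : 0 < (ε / 2) ^ 2 / (K + 1) := by positivity
  obtain ⟨_, ⟨e₀, he0, he1, rfl⟩, hlt⟩ := exists_lt_of_lt_csSup hSne
    (sub_lt_self (sSup S) hη)
  have hev : ∀ᶠ e in CStarAlgebra.approximateUnit J, e₀ ≤ e ∧ ‖e‖ ≤ 1 := by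
    filter_upwards [(CStarAlgebra.hasBasis_approximateUnit J).mem_of_mem ⟨he0, he1⟩] with e he
    exact ⟨he.1, by simpa using he.2⟩
  obtain ⟨k, hk⟩ := hi x e₀
  have hlim : Tendsto (fun e : J => ω ((1 - i e) * x * i e₀)) (CStarAlgebra.approximateUnit J)
      (𝓝 0) := by
    have h1 := (CStarAlgebra.increasingApproximateUnit J).tendsto_mul_right k
    have hic : Continuous i := AddMonoidHomClass.continuous_of_bound i 1 fun x => by
      simpa using NonUnitalStarAlgHom.norm_apply_le i x
    have h2 := (hω.continuous.tendsto _).comp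
      (tendsto_const_nhds (x := i k) |>.sub ((hic.tendsto _).comp h1))
    rw [sub_self, map_zero] at h2
    refine h2.congr fun e => ?_
    simp only [Function.comp_apply]
    rw [mul_assoc, hk, sub_mul, one_mul, map_mul]
  filter_upwards [hev, Metric.tendsto_nhds.1 hlim (ε / 2) (half_pos hε)] with e he h1
  rw [dist_zero_right] at h1 ⊢
  have hie0 : 0 ≤ i e := by simpa using i.le_of_le (he0.trans he.1)
  have hie1 := i.le_one_of_norm_le (he0.trans he.1) he.2
  have hd0 : 0 ≤ i e - i e₀ := sub_nonneg.2 (i.le_of_le he.1)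
  have hd1 : i e - i e₀ ≤ 1 := (sub_le_self _ (by simpa using i.le_of_le he0)).trans hie1
  have h2 : ‖ω ((1 - i e) * x * (i e - i e₀))‖ ≤ ε / 2 := by
    refine le_of_sq_le_sq ?_ (by positivity)
    have h3 := hω.isHermForm.norm_sq_le hω.re_nonneg (star ((1 - i e) * x)) (i e - i e₀)
    rw [star_star] at h3
    refine h3.trans ?_
    have h4 := hω.re_star_mul_self_le (star ((1 - i e) * x))
    rw [star_star, norm_star] at h4
    have h5 : ‖(1 - i e) * x‖ ≤ ‖x‖ := by
      refine (norm_mul_le _ _).trans ?_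
      exact mul_le_of_le_one_left (norm_nonneg _) (norm_one_sub_le_one hie0 hie1)
    have h6 : (ω ((1 - i e) * x * star ((1 - i e) * x))).re ≤ K :=
      h4.trans (mul_le_mul_of_nonneg_left (pow_le_pow_left₀ (norm_nonneg _) h5 2) hω1)
    have h7 : (ω (star (i e - i e₀) * (i e - i e₀))).re ≤ (ε / 2) ^ 2 / (K + 1) := by
      rw [hd0.isSelfAdjoint.star_eq]
      refine (hω.re_mono (mul_self_le_of_nonneg_of_le_one hd0 hd1)).trans ?_
      rw [map_sub, Complex.sub_re]
      have := hle e (he0.trans he.1) he.2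
      linarith
    calc _ ≤ K * ((ε / 2) ^ 2 / (K + 1)) := mul_le_mul h6 h7 (hω.re_nonneg _) hK
      _ ≤ (ε / 2) ^ 2 := by
        rw [mul_div_assoc', div_le_iff₀ (by positivity)]
        nlinarith [sq_nonneg (ε / 2)]
  have e3 : (1 - i e) * x * i e = (1 - i e) * x * i e₀ + (1 - i e) * x * (i e - i e₀) := by
    rw [← mul_add, add_sub_cancel]
  rw [e3, map_add]
  refine (norm_add_le _ _).trans_lt ?_
  linarith

end ApproximateUnit

section KernelUnit

variable {A B : Type*} [CStarAlgebra A] [PartialOrder A] [StarOrderedRing A] [CStarAlgebra B]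

/-- The kernel of a *-homomorphism has an approximate unit which is weakly central. -/
lemma exists_kernel_unit (π : A →⋆ₐ[ℂ] B) :
    ∃ l : Filter A, l.NeBot ∧ (∀ᶠ e in l, π e = 0 ∧ 0 ≤ e ∧ e ≤ 1) ∧
      (∀ y, π y = 0 → Tendsto (fun e => (1 - e) * y) l (𝓝 0)) ∧
      (∀ (Λ : A →L[ℂ] ℂ) x, Tendsto (fun e => Λ ((1 - e) * x * e)) l (𝓝 0)) ∧
      ∀ (Λ : A →L[ℂ] ℂ) x, Tendsto (fun e => Λ (e * x * (1 - e))) l (𝓝 0) := by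
  have hπc : Continuous π := AddMonoidHomClass.continuous_of_bound π 1 fun x => by
    simpa using NonUnitalStarAlgHom.norm_apply_le π x
  let J : NonUnitalStarSubalgebra ℂ A :=
    { carrier := {x | π x = 0}
      add_mem' := fun {x y} hx hy => by
        have h1 : π x = 0 := hx
        have h2 : π y = 0 := hy
        change π (x + y) = 0
        rw [map_add, h1, h2, add_zero]
      zero_mem' := map_zero π
      mul_mem' := fun {x y} hx _ => by
        have h1 : π x = 0 := hx
        change π (x * y) = 0
        rw [map_mul, h1, zero_mul]
      smul_mem' := fun c x hx => by
        have h1 : π x = 0 := hx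
        change π (c • x) = 0
        rw [map_smul, h1, smul_zero]
      star_mem' := fun {x} hx => by
        have h1 : π x = 0 := hx
        change π (star x) = 0
        rw [map_star, h1, star_zero] }
  have hJ : ∀ x, x ∈ J ↔ π x = 0 := fun _ => Iff.rfl
  have hcl : IsClosed (J : Set A) := isClosed_singleton.preimage hπc
  let _ : NonUnitalCStarAlgebra J := NonUnitalStarSubalgebra.nonUnitalCStarAlgebra J
  let i : J →⋆ₙₐ[ℂ] A := NonUnitalStarSubalgebraClass.subtype J
  have hi : ∀ j, i j = j := fun _ => rfl
  let _ : PartialOrder J := CStarAlgebra.spectralOrder J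
  have _ : StarOrderedRing J := CStarAlgebra.spectralOrderedRing J
  have hid : ∀ (x : A) (j : J), ∃ k, x * i j = i k := fun x j =>
    ⟨⟨x * i j, by rw [hJ, map_mul, hi, (hJ _).1 j.2, mul_zero]⟩, rfl⟩
  have hun := CStarAlgebra.increasingApproximateUnit J
  have hev : ∀ᶠ e in (CStarAlgebra.approximateUnit J).map i, π e = 0 ∧ 0 ≤ e ∧ e ≤ 1 := by
    rw [eventually_map]
    filter_upwards [hun.eventually_nonneg, hun.eventually_norm] with e h0 h1
    exact ⟨(hJ _).1 e.2, by simpa using i.le_of_le h0, i.le_one_of_norm_le h0 h1⟩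
  have hic : Continuous i := AddMonoidHomClass.continuous_of_bound i 1 fun x => by
    simpa using NonUnitalStarAlgHom.norm_apply_le i x
  have hspan : ∀ p : A → A → A, (∀ ω : A →ₗ[ℂ] ℂ, IsPosFun ω → ∀ x, Tendsto (fun e => ω (p x e))
      ((CStarAlgebra.approximateUnit J).map i) (𝓝 0)) → ∀ (Λ : A →L[ℂ] ℂ) x,
      Tendsto (fun e => Λ (p x e)) ((CStarAlgebra.approximateUnit J).map i) (𝓝 0) := by
    intro p hp Λ x
    obtain hsub | hnt := subsingleton_or_nontrivial A
    · refine tendsto_const_nhds.congr fun e => ?_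
      rw [Subsingleton.elim (p x e) 0, map_zero]
    · have hΛ := mem_span_isPosFun (Λ : A →ₗ[ℂ] ℂ) (C := ‖Λ‖) Λ.le_opNorm
      change Tendsto (fun e => (Λ : A →ₗ[ℂ] ℂ) (p x e)) _ _
      generalize (Λ : A →ₗ[ℂ] ℂ) = f at hΛ
      induction hΛ using Submodule.span_induction with
      | mem f hf => exact hp f hf x
      | zero => exact tendsto_const_nhds
      | add f g _ _ hf hg => simpa using hf.add hg
      | smul c f _ hf => simpa using hf.const_mul c
  have hweak : ∀ ω : A →ₗ[ℂ] ℂ, IsPosFun ω → ∀ x, Tendsto (fun e => ω ((1 - e) * x * e))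
      ((CStarAlgebra.approximateUnit J).map i) (𝓝 0) := fun ω hω x =>
    tendsto_map'_iff.2 (tendsto_posFun_one_sub_mul_mul i hid hω x)
  refine ⟨(CStarAlgebra.approximateUnit J).map i, inferInstance, hev, fun y hy => ?_,
    hspan (fun x e => (1 - e) * x * e) hweak, hspan (fun x e => e * x * (1 - e)) ?_⟩
  · rw [tendsto_map'_iff]
    have h2 := tendsto_const_nhds (x := y) |>.sub
      ((hic.tendsto _).comp (hun.tendsto_mul_right ⟨y, (hJ y).2 hy⟩))
    rw [hi, sub_self] at h2
    refine h2.congr fun e => ?_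
    simp only [Function.comp_apply]
    rw [sub_mul, one_mul, map_mul, hi ⟨y, _⟩]
  · intro ω hω x
    have h := (hweak ω hω (star x)).star
    rw [star_zero] at h
    refine h.congr' ?_
    filter_upwards [hev] with e he
    rw [← hω.map_star]
    simp only [star_mul, star_sub, star_one, star_star, he.2.1.isSelfAdjoint.star_eq, mul_assoc]

end KernelUnit

end

section

open scoped ComplexOrder
open Filter Topology

section Gluing

variable {A B : Type*} [CStarAlgebra A] [CStarAlgebra B]

/-- The interpolation of two maps along a positive contraction `e`. -/
noncomputable def interpolate (e : A) (θ₀ θ₁ : B →ₗ[ℂ] A) : B →ₗ[ℂ] A :=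
  LinearMap.mulLeftRight ℂ (e, e) ∘ₗ θ₀ + LinearMap.mulLeftRight ℂ (1 - e, 1 - e) ∘ₗ θ₁

lemma interpolate_apply (e : A) (θ₀ θ₁ : B →ₗ[ℂ] A) (b : B) :
    interpolate e θ₀ θ₁ b = e * θ₀ b * e + (1 - e) * θ₁ b * (1 - e) := by
  simp only [interpolate, LinearMap.add_apply, LinearMap.comp_apply,
    LinearMap.mulLeftRight_apply]

lemma IsFamilyCP.interpolate {e : A} (he : IsSelfAdjoint e) {θ₀ θ₁ : B →ₗ[ℂ] A}
    (h₀ : IsFamilyCP θ₀) (h₁ : IsFamilyCP θ₁) : IsFamilyCP (interpolate e θ₀ θ₁) := by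
  have h := (h₀.conj e).add (h₁.conj (1 - e))
  have e1 : star (1 - e) = 1 - e := by rw [star_sub, star_one, he.star_eq]
  rw [he.star_eq, e1] at h
  rwa [funext (interpolate_apply e θ₀ θ₁)]

variable [PartialOrder A] [StarOrderedRing A]

lemma interpolate_one_le {e : A} (h0 : 0 ≤ e) (h1 : e ≤ 1) {θ₀ θ₁ : B →ₗ[ℂ] A}
    (h₀ : θ₀ 1 ≤ 1) (h₁ : θ₁ 1 ≤ 1) : _root_.interpolate e θ₀ θ₁ 1 ≤ 1 := by
  rw [interpolate_apply]
  have h1' : 0 ≤ 1 - e := sub_nonneg.2 h1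
  have a := h0.isSelfAdjoint.conjugate_le_conjugate h₀
  have b := h1'.isSelfAdjoint.conjugate_le_conjugate h₁
  rw [mul_one] at a b
  calc _ ≤ e + (1 - e) := add_le_add (a.trans (mul_self_le_of_nonneg_of_le_one h0 h1))
        (b.trans (mul_self_le_of_nonneg_of_le_one h1' (sub_le_self 1 h0)))
    _ = 1 := add_sub_cancel _ _

/-- A lift can be moved near another one without changing its image in the quotient. -/
lemma exists_glued_lift {π : A →⋆ₐ[ℂ] B} {C : ℝ} (hC0 : 0 ≤ C)
    (hC : ∀ b, ∃ a, π a = b ∧ ‖a‖ ≤ C * ‖b‖) {θ₀ θ₁ : B →ₗ[ℂ] A} (h₀ : IsFamilyCP θ₀)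
    (h₁ : IsFamilyCP θ₁) (h₀1 : θ₀ 1 ≤ 1) (h₁1 : θ₁ 1 ≤ 1) (F : Finset B) {δ r : ℝ}
    (hδ0 : 0 ≤ δ) (hδ : ∀ b ∈ F, ‖π (θ₁ b) - π (θ₀ b)‖ ≤ δ) (hr : C * δ < r) :
    ∃ θ₂ : B →ₗ[ℂ] A, IsFamilyCP θ₂ ∧ θ₂ 1 ≤ 1 ∧ (∀ b, π (θ₂ b) = π (θ₁ b)) ∧
      ∀ b ∈ F, ‖θ₂ b - θ₀ b‖ < r := by
  have hr0 : 0 < r := (mul_nonneg hC0 hδ0).trans_lt hr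
  let t : Set (F → A) := {v | ∃ θ : B →ₗ[ℂ] A, IsFamilyCP θ ∧ θ 1 ≤ 1 ∧
    (∀ b, π (θ b) = π (θ₁ b)) ∧ ∀ b, v b = θ b - θ₀ b}
  have ht : Convex ℝ t := by
    rintro v ⟨θ, h1, h2, h3, h4⟩ w ⟨θ', h1', h2', h3', h4'⟩ s s' hs hs' hss
    have hssc : (s : ℂ) + s' = 1 := by exact_mod_cast hss
    refine ⟨(s : ℂ) • θ + (s' : ℂ) • θ', (h1.smul hs).add (h1'.smul hs'), ?_, fun b => ?_,
      fun b => ?_⟩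
    · have e : ((s : ℂ) • θ + (s' : ℂ) • θ') 1 = s • θ 1 + s' • θ' 1 := rfl
      rw [e]
      refine (add_le_add (smul_le_smul_of_nonneg_left h2 hs)
        (smul_le_smul_of_nonneg_left h2' hs')).trans ?_
      rw [← add_smul, hss, one_smul]
    · have e : ((s : ℂ) • θ + (s' : ℂ) • θ') b = (s : ℂ) • θ b + (s' : ℂ) • θ' b := rfl
      rw [e, map_add, map_smul, map_smul, h3, h3', ← add_smul, hssc, one_smul]
    · have e : (s • v + s' • w) b = (s : ℂ) • v b + (s' : ℂ) • w b := rfl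
      have e' : ((s : ℂ) • θ + (s' : ℂ) • θ') b = (s : ℂ) • θ b + (s' : ℂ) • θ' b := rfl
      rw [e, e', h4, h4', smul_sub, smul_sub]
      have : θ₀ b = (s : ℂ) • θ₀ b + (s' : ℂ) • θ₀ b := by rw [← add_smul, hssc, one_smul]
      nth_rewrite 3 [this]
      abel
  by_cases hdisj : Disjoint (Metric.ball (0 : F → A) r) t
  swap
  · obtain ⟨v, hv, θ, h1, h2, h3, h4⟩ := Set.not_disjoint_iff.1 hdisj
    refine ⟨θ, h1, h2, h3, fun b hb => ?_⟩
    rw [← h4 ⟨b, hb⟩]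
    exact (norm_le_pi_norm v _).trans_lt (mem_ball_zero_iff.1 hv)
  exfalso
  obtain ⟨Λ, u, hΛ, hu⟩ := RCLike.geometric_hahn_banach_open (𝕜 := ℂ) (convex_ball 0 r)
    Metric.isOpen_ball ht hdisj
  have hu0 : 0 < u := by simpa using hΛ 0 (Metric.mem_ball_self hr0)
  classical
  have hΛs : ∀ v, Λ v = ∑ k, (Λ ∘L ContinuousLinearMap.single ℂ (fun _ : F => A) k) (v k) := by
    intro v
    simp only [ContinuousLinearMap.comp_apply, ← map_sum]
    congr 1
    ext k
    simp [Finset.sum_apply, Pi.single_apply]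
  obtain ⟨l, hl, hev, hun, hw1, hw2⟩ := exists_kernel_unit π
  choose a ha hab using fun b : F => hC (π (θ₁ b - θ₀ b))
  have hker : ∀ b : F, π (θ₁ b - θ₀ b - a b) = 0 := fun b => by rw [map_sub, ha, sub_self]
  obtain ⟨r', hr'1, hr'2⟩ := exists_between hr
  have hr'0 : 0 < r' := (mul_nonneg hC0 hδ0).trans_lt hr'1
  let p : A → F → A := fun e b => (1 - e) * (θ₁ b - θ₀ b) * (1 - e)
  let q : A → F → A := fun e b => e * θ₀ b * (1 - e) + (1 - e) * θ₀ b * e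
  have hp : ∀ᶠ e in l, ‖p e‖ ≤ r' := by
    have h : ∀ᶠ e in l, ∀ b : F, ‖(1 - e) * (θ₁ b - θ₀ b - a b)‖ < r' - C * δ :=
      eventually_all.2 fun b => by
        simpa only [dist_zero_right] using
          Metric.tendsto_nhds.1 (hun _ (hker b)) (r' - C * δ) (sub_pos.2 hr'1)
    filter_upwards [h, hev] with e he he'
    have hn := norm_one_sub_le_one he'.2.1 he'.2.2
    refine (pi_norm_le_iff_of_nonneg hr'0.le).2 fun b => ?_
    refine (norm_mul_le _ _).trans ((mul_le_of_le_one_right (norm_nonneg _) hn).trans ?_)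
    have e1 : (1 - e) * (θ₁ b - θ₀ b) = (1 - e) * (θ₁ b - θ₀ b - a b) + (1 - e) * a b := by
      rw [← mul_add, sub_add_cancel]
    have h2 : ‖(1 - e) * a b‖ ≤ C * δ := by
      refine (norm_mul_le _ _).trans ((mul_le_of_le_one_left (norm_nonneg _) hn).trans ?_)
      refine (hab b).trans (mul_le_mul_of_nonneg_left ?_ hC0)
      rw [map_sub]
      exact hδ b b.2
    rw [e1]
    refine (norm_add_le _ _).trans ?_
    linarith [he b]
  have hq : Tendsto (fun e => Λ (q e)) l (𝓝 0) := by
    simp only [hΛs, q, map_add]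
    rw [← Finset.sum_const_zero (s := (Finset.univ : Finset F)), ← add_zero (0 : ℂ)]
    exact tendsto_finsetSum _ fun k _ => (hw2 _ _).add (hw1 _ _)
  have hs1 : 1 < (r + r') / (2 * r') := by rw [one_lt_div (by positivity)]; linarith
  have hsr : (r + r') / (2 * r') * r' < r := by
    have : (r + r') / (2 * r') * r' = (r + r') / 2 := by field_simp
    linarith
  generalize (r + r') / (2 * r') = s at hs1 hsr
  have hs0 : 0 < s := one_pos.trans hs1
  have hΛp : ∀ᶠ e in l, (Λ (p e)).re < s⁻¹ * u := by
    filter_upwards [hp] with e he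
    have hmem : (s : ℂ) • p e ∈ Metric.ball (0 : F → A) r := by
      rw [mem_ball_zero_iff, norm_smul, Complex.norm_real, Real.norm_of_nonneg hs0.le]
      exact (mul_le_mul_of_nonneg_left he hs0.le).trans_lt hsr
    have h := hΛ _ hmem
    rw [map_smul, smul_eq_mul] at h
    rw [inv_mul_eq_div, lt_div_iff₀' hs0]
    exact (Complex.re_ofReal_mul _ _).symm.trans_lt h
  have hsu : 0 < u - s⁻¹ * u := by
    rw [← one_sub_mul]
    exact mul_pos (sub_pos.2 (inv_lt_one_of_one_lt₀ hs1)) hu0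
  obtain ⟨e, he1, he2, he3⟩ := (hΛp.and (hev.and (Metric.tendsto_nhds.1 hq _ hsu))).exists
  rw [dist_zero_right] at he3
  have hmem : p e - q e ∈ t := by
    refine ⟨interpolate e θ₀ θ₁, h₀.interpolate he2.2.1.isSelfAdjoint h₁,
      interpolate_one_le he2.2.1 he2.2.2 h₀1 h₁1, fun b => ?_, fun b => ?_⟩
    · rw [interpolate_apply]
      simp [he2.1]
    · rw [interpolate_apply]
      simp only [Pi.sub_apply, p, q]
      noncomm_ring
  have h := hu _ hmem
  rw [map_sub] at h
  have h' : u ≤ (Λ (p e)).re - (Λ (q e)).re := h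
  have := (Complex.abs_re_le_norm (Λ (q e)))
  have := neg_abs_le (Λ (q e)).re
  linarith

end Gluing

end

section

open scoped ComplexOrder
open Filter Topology

section ExactSection

variable {A B : Type*} [CStarAlgebra A] [PartialOrder A] [StarOrderedRing A]
  [CStarAlgebra B] [PartialOrder B] [StarOrderedRing B]

/-- A sequence of contractive lifts converging on a dense sequence to a section. -/
lemma exists_seq_lift (hA : ApproxFactorable A) {π : A →⋆ₐ[ℂ] B} (hπ : Function.Surjective π)
    (d : ℕ → B) :
    ∃ (S : ℕ → B →ₗ[ℂ] A), (∀ n, IsFamilyCP (S n) ∧ S n 1 ≤ 1) ∧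
      (∀ k, CauchySeq fun n => S n (d k)) ∧ ∀ k, Tendsto (fun n => π (S n (d k))) atTop
        (𝓝 (d k)) := by
  classical
  have hπc : Continuous π := AddMonoidHomClass.continuous_of_bound π 1 fun x => by
    simpa using NonUnitalStarAlgHom.norm_apply_le π x
  let πL : A →L[ℂ] B := ⟨(π : A →ₐ[ℂ] B).toLinearMap, hπc⟩
  obtain ⟨C, hC0, hC⟩ := πL.exists_preimage_norm_le hπ
  let F : ℕ → Finset B := fun n => (Finset.range n).image d
  let δ : ℕ → ℝ := fun n => (1 / 2) ^ n
  have hδ : ∀ n, 0 < δ n := fun n => by positivity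
  have hδs : ∀ n, δ (n + 1) ≤ δ n := fun n =>
    pow_le_pow_of_le_one (by norm_num) (by norm_num) n.le_succ
  have hF : ∀ n, F n ⊆ F (n + 1) := fun n => Finset.image_subset_image
    (Finset.range_mono n.le_succ)
  let P : ℕ → Type _ := fun n => {θ : B →ₗ[ℂ] A // (IsFamilyCP θ ∧ θ 1 ≤ 1) ∧
    ∀ b ∈ F n, ‖π (θ b) - b‖ ≤ δ n}
  have hstep : ∀ n (θ : P n), ∃ θ' : P (n + 1), ∀ b ∈ F n,
      ‖θ'.1 b - θ.1 b‖ ≤ (2 * C + 1) * δ n := by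
    rintro n ⟨θ, ⟨h1, h2⟩, h3⟩
    obtain ⟨θ₁, h1', h2', h3'⟩ := exists_approx_lift hA hπ (F (n + 1)) (hδ (n + 1))
    obtain ⟨θ₂, h1'', h2'', h3'', h4⟩ := exists_glued_lift hC0.le hC h1 h1' h2 h2' (F n)
      (δ := 2 * δ n) (r := (2 * C + 1) * δ n) (by linarith [hδ n]) (fun b hb => by
        have e : π (θ₁ b) - π (θ b) = (π (θ₁ b) - b) - (π (θ b) - b) := by abel
        rw [e]
        refine (norm_sub_le _ _).trans ?_
        linarith [h3 b hb, h3' b (hF n hb), hδs n]) (by linarith [hδ n])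
    exact ⟨⟨θ₂, ⟨h1'', h2''⟩, fun b hb => by rw [h3'']; exact (h3' b hb).le⟩,
      fun b hb => (h4 b hb).le⟩
  choose next hnext using hstep
  let T : ∀ n, P n := fun n => Nat.rec ⟨0, ⟨IsFamilyCP.zero, by simp⟩, by simp [F]⟩ next n
  have hT : ∀ n, ∀ b ∈ F n, ‖(T (n + 1)).1 b - (T n).1 b‖ ≤ (2 * C + 1) * δ n :=
    fun n => hnext n (T n)
  have hmem : ∀ {k n}, k < n → d k ∈ F n := fun h =>
    Finset.mem_image_of_mem _ (Finset.mem_range.2 h)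
  refine ⟨fun n => (T n).1, fun n => (T n).2.1, fun k => ?_, fun k => ?_⟩
  · refine cauchySeq_of_le_geometric (1 / 2) (2 * C + 1 + 2 * ‖d k‖ * 2 ^ k) (by norm_num)
      fun n => ?_
    rw [dist_comm, dist_eq_norm, add_mul]
    rcases lt_or_ge k n with h | h
    · refine (hT n _ (hmem h)).trans (le_add_of_nonneg_right (by positivity))
    · have hb := fun m => (T m).2.1.1.norm_map_le (T m).2.1.2 (d k)
      have h5 : 2 * ‖d k‖ ≤ 2 * ‖d k‖ * 2 ^ k * (1 / 2) ^ n := by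
        rw [mul_assoc]
        refine le_mul_of_one_le_right (by positivity) ?_
        calc (1 : ℝ) = 2 ^ n * (1 / 2) ^ n := by rw [← mul_pow]; norm_num
          _ ≤ 2 ^ k * (1 / 2) ^ n := mul_le_mul_of_nonneg_right
            (pow_le_pow_right₀ (by norm_num) h) (by positivity)
      have : 0 ≤ (2 * C + 1) * (1 / 2) ^ n := by positivity
      refine (norm_sub_le _ _).trans ?_
      linarith [hb n, hb (n + 1)]
  · rw [tendsto_iff_norm_sub_tendsto_zero]
    refine squeeze_zero' (Eventually.of_forall fun _ => norm_nonneg _) ?_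
      (tendsto_pow_atTop_nhds_zero_of_lt_one (r := (1 / 2 : ℝ)) (by norm_num) (by norm_num))
    filter_upwards [eventually_gt_atTop k] with n hn
    exact (T n).2.2 _ (hmem hn)

/-- The Choi-Effros lifting theorem for unital C*-algebras. -/
lemma exists_section_of_approxFactorable [TopologicalSpace.SeparableSpace A]
    (hA : ApproxFactorable A) {π : A →⋆ₐ[ℂ] B} (hπ : Function.Surjective π) :
    ∃ (θ : B →ₗ[ℂ] A) (S : ℕ → B →ₗ[ℂ] A), (∀ n, IsFamilyCP (S n) ∧ S n 1 ≤ 1) ∧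
      (∀ b, Tendsto (fun n => S n b) atTop (𝓝 (θ b))) ∧ (∀ b, ‖θ b‖ ≤ ‖b‖) ∧
      ∀ b, π (θ b) = b := by
  have hπc : Continuous π := AddMonoidHomClass.continuous_of_bound π 1 fun x => by
    simpa using NonUnitalStarAlgHom.norm_apply_le π x
  have _ : TopologicalSpace.SeparableSpace B := hπ.denseRange.separableSpace hπc
  obtain ⟨S, hS, hc, hl⟩ := exists_seq_lift hA hπ (TopologicalSpace.denseSeq B)
  have hd := TopologicalSpace.denseRange_denseSeq B
  have hSn : ∀ n b, ‖S n b‖ ≤ ‖b‖ := fun n => (hS n).1.norm_map_le (hS n).2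
  have hcauchy : ∀ b, CauchySeq fun n => S n b := by
    intro b
    rw [Metric.cauchySeq_iff']
    intro ε hε
    obtain ⟨k, hk⟩ := Metric.denseRange_iff.1 hd b (ε / 4) (by positivity)
    obtain ⟨N, hN⟩ := Metric.cauchySeq_iff'.1 (hc k) (ε / 2) (by positivity)
    refine ⟨N, fun n hn => ?_⟩
    have h1 := hN n hn
    rw [dist_eq_norm] at hk h1 ⊢
    set x := TopologicalSpace.denseSeq B k
    have e : S n b - S N b = S n (b - x) - S N (b - x) + (S n x - S N x) := by
      simp only [map_sub]; abel
    rw [e]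
    refine (norm_add_le _ _).trans_lt ?_
    have := norm_sub_le (S n (b - x)) (S N (b - x))
    linarith [hSn n (b - x), hSn N (b - x)]
  choose f hf using fun b => cauchySeq_tendsto_of_complete (hcauchy b)
  let θ : B →ₗ[ℂ] A := linearMapOfTendsto f S (tendsto_pi_nhds.2 hf)
  have hθn : ∀ b, ‖θ b‖ ≤ ‖b‖ := fun b => le_of_tendsto' (hf b).norm fun n => hSn n b
  refine ⟨θ, S, hS, hf, hθn, fun b => ?_⟩
  have hθc : Continuous θ := AddMonoidHomClass.continuous_of_bound θ 1 fun x => by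
    simpa using hθn x
  refine congrFun (hd.equalizer (hπc.comp hθc) continuous_id (funext fun k => ?_)) b
  exact tendsto_nhds_unique ((hπc.tendsto _).comp (hf _)) (hl k)

end ExactSection

end

section

open scoped ComplexOrder
open Filter Topology

section MatrixMaps

variable {ι κ : Type*} [Fintype ι] [Fintype κ]

lemma isFamilyCP_submatrix (f : κ → ι) :
    IsFamilyCP fun S : Matrix ι ι ℂ => S.submatrix f f := by
  refine IsFamilyCP.of_fintype fun n c => ?_
  obtain h | ⟨⟨k₀⟩⟩ := isEmpty_or_nonempty κ
  · exact ⟨Empty, inferInstance, fun _ _ => 0, fun p q => Subsingleton.elim _ _⟩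
  · classical
    refine ⟨Fin (Fintype.card ι), inferInstance, fun r p => Matrix.of fun a b =>
      if a = k₀ then c p ((Fintype.equivFin ι).symm r) (f b) else 0, fun p q => ?_⟩
    ext a b
    rw [Matrix.sum_apply]
    simp only [Matrix.submatrix_apply, Matrix.mul_apply, Matrix.star_apply, Matrix.of_apply]
    rw [← (Fintype.equivFin ι).symm.sum_comp]
    refine Finset.sum_congr rfl fun r _ => ?_
    rw [Finset.sum_eq_single k₀]
    · simp
    · intro b _ hb
      simp [hb]
    · simp

lemma isFamilyCP_apply_smul {X : Type*} [CStarAlgebra X] [PartialOrder X] [StarOrderedRing X]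
    (a : ι) {p : X} (hp : 0 ≤ p) : IsFamilyCP fun S : Matrix ι ι ℂ => S a a • p := by
  obtain ⟨w, rfl⟩ := exists_eq_star_mul_self_of_nonneg hp
  refine IsFamilyCP.of_fintype fun n c => ?_
  refine ⟨Fin (Fintype.card ι), inferInstance, fun r p => c p ((Fintype.equivFin ι).symm r) a • w,
    fun p q => ?_⟩
  simp only [Matrix.mul_apply, Matrix.star_apply]
  rw [← (Fintype.equivFin ι).symm.sum_comp, Finset.sum_smul]
  refine Finset.sum_congr rfl fun r _ => ?_
  rw [star_smul, smul_mul_smul_comm]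

open scoped MatrixOrder in
lemma Matrix.PosDef.exists_sqrt [DecidableEq ι] {a : Matrix ι ι ℂ} (ha : a.PosDef) :
    ∃ t s : Matrix ι ι ℂ, star t = t ∧ star s = s ∧ t * s = 1 ∧ s * t = 1 ∧ t * t = a := by
  have h0 : 0 ≤ a := Matrix.nonneg_iff_posSemidef.2 ha.posSemidef
  have h1 : CFC.sqrt a * CFC.sqrt a = a := CFC.sqrt_mul_sqrt_self a
  have hs : star (CFC.sqrt a) = CFC.sqrt a := (CFC.sqrt_nonneg a).isSelfAdjoint
  have hu : IsUnit (CFC.sqrt a) :=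
    ((Commute.refl (CFC.sqrt a)).isUnit_mul_iff.1 (by rw [h1]; exact ha.isUnit)).1
  obtain ⟨u, hu⟩ := hu
  refine ⟨CFC.sqrt a, ↑u⁻¹, hs, ?_, by rw [← hu, u.mul_inv], by rw [← hu, u.inv_mul], h1⟩
  have e : star u = u := Units.ext (by rw [Units.coe_star, hu, hs])
  rw [← Units.coe_star, star_inv, e]

end MatrixMaps

section Factor

variable {X : Type*} [CStarAlgebra X] [PartialOrder X] [StarOrderedRing X]

/-- A small multiple of the trace makes the second leg of a factorisation faithful. -/
lemma exists_faithful_factorization {ι : Type} [Fintype ι] [DecidableEq ι] [Nonempty ι]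
    {φ : X →ₗ[ℂ] Matrix ι ι ℂ} {ψ : Matrix ι ι ℂ →ₗ[ℂ] X} (hφ : IsFamilyCP φ) (hφ1 : φ 1 = 1)
    (hψ : IsFamilyCP ψ) (hψ1 : ψ 1 ≤ 1) (F : Finset X) {ε : ℝ} (h : ∀ x ∈ F, ‖ψ (φ x) - x‖ < ε) :
    ∃ N : MatrixFactorization X, ∀ x ∈ F, ‖N.ψ (N.φ x) - x‖ < ε := by
  let n : ℝ := Fintype.card ι
  have hn : 0 < n := Nat.cast_pos.2 Fintype.card_pos
  let T : Matrix ι ι ℂ →ₗ[ℂ] X := (LinearMap.toSpanSingleton ℂ X 1) ∘ₗ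
    (((n⁻¹ : ℝ) : ℂ) • Matrix.traceLinearMap ι ℂ ℂ)
  have hT : ∀ S, T S = ((n⁻¹ : ℝ) : ℂ) • S.trace • (1 : X) := fun S => by
    simp [T, smul_smul]
  have hTcp : IsFamilyCP T := by
    have h1 : IsFamilyCP fun S : Matrix ι ι ℂ => ∑ a, S a a • (1 : X) :=
      IsFamilyCP.sum _ fun a _ => isFamilyCP_apply_smul a zero_le_one
    have h2 := h1.smul (inv_nonneg.2 hn.le)
    convert h2 using 2 with S
    rw [hT, Matrix.trace, Finset.sum_smul]; rfl
  have hT1 : T 1 = 1 := by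
    have : (n : ℂ) ≠ 0 := by exact_mod_cast hn.ne'
    rw [hT, Matrix.trace_one, smul_smul]
    have e : ((n⁻¹ : ℝ) : ℂ) * (Fintype.card ι : ℂ) = 1 := by
      rw [Complex.ofReal_inv]
      exact inv_mul_cancel₀ this
    rw [e, one_smul]
  have htend : ∀ x, Tendsto (fun s : ℝ => ‖((1 - s : ℝ) : ℂ) • ψ (φ x) + (s : ℂ) • T (φ x) - x‖)
      (𝓝[>] 0) (𝓝 ‖ψ (φ x) - x‖) := by
    intro x
    have hc : Continuous fun s : ℝ =>
        ‖((1 - s : ℝ) : ℂ) • ψ (φ x) + (s : ℂ) • T (φ x) - x‖ := by fun_prop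
    have := (hc.tendsto 0).mono_left (nhdsWithin_le_nhds (s := Set.Ioi 0))
    simpa using this
  have hev : ∀ᶠ s : ℝ in 𝓝[>] 0, (∀ x ∈ F,
      ‖((1 - s : ℝ) : ℂ) • ψ (φ x) + (s : ℂ) • T (φ x) - x‖ < ε) :=
    (F.eventually_all).2 fun x hx => (htend x).eventually_lt_const (h x hx)
  obtain ⟨s, hs, hs0, hs1⟩ := (hev.and (Ioo_mem_nhdsGT (zero_lt_one' ℝ))).exists
  have hs1' : 0 ≤ 1 - s := sub_nonneg.2 hs1.le
  refine ⟨⟨ι, φ, ((1 - s : ℝ) : ℂ) • ψ + (s : ℂ) • T, hφ, hφ1,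
    (hψ.smul hs1').add (hTcp.smul hs0.le), ?_, s * n⁻¹, by positivity, fun S => ?_⟩, hs⟩
  · have e : (((1 - s : ℝ) : ℂ) • ψ + (s : ℂ) • T) 1 = (1 - s) • ψ 1 + s • T 1 := rfl
    rw [e, hT1]
    calc _ ≤ (1 - s) • (1 : X) + s • (1 : X) :=
          add_le_add_left (smul_le_smul_of_nonneg_left hψ1 hs1') _
      _ = 1 := by rw [← add_smul, sub_add_cancel, one_smul]
  · have e : (((1 - s : ℝ) : ℂ) • ψ + (s : ℂ) • T) (star S * S) =
        (1 - s) • ψ (star S * S) + (s : ℂ) • T (star S * S) := rfl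
    rw [e, hT, smul_smul, smul_smul]
    push_cast
    exact le_add_of_nonneg_left (smul_nonneg hs1' (hψ.map_star_mul_self_nonneg S))

/-- A character turns a contractive second leg into a unital factorisation. -/
lemma exists_block_factorization (χ : X →⋆ₐ[ℂ] ℂ) {k : ℕ}
    {φ : X →ₗ[ℂ] Matrix (Fin k) (Fin k) ℂ} {ψ : Matrix (Fin k) (Fin k) ℂ →ₗ[ℂ] X}
    (hφ : IsFamilyCP φ) (hφ1 : φ 1 = 1) (hψ : IsFamilyCP ψ) (hψ1 : ψ 1 ≤ 1) :
    ∃ (φ' : X →ₗ[ℂ] Matrix (Fin k ⊕ Unit) (Fin k ⊕ Unit) ℂ)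
      (ψ' : Matrix (Fin k ⊕ Unit) (Fin k ⊕ Unit) ℂ →ₗ[ℂ] X),
      IsFamilyCP φ' ∧ φ' 1 = 1 ∧ IsFamilyCP ψ' ∧ ψ' 1 ≤ 1 ∧
      ∀ x, ψ' (φ' x) = ψ (φ x) + χ x • (1 - ψ 1) := by
  let φ' : X →ₗ[ℂ] Matrix (Fin k ⊕ Unit) (Fin k ⊕ Unit) ℂ :=
    { toFun := fun x => Matrix.fromBlocks (φ x) 0 0 (Matrix.of fun _ _ => χ x)
      map_add' := fun x y => by
        rw [Matrix.fromBlocks_add]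
        congr 1 <;> ext <;> simp
      map_smul' := fun t x => by
        rw [RingHom.id_apply, Matrix.fromBlocks_smul]
        congr 1 <;> ext <;> simp }
  let ψ' : Matrix (Fin k ⊕ Unit) (Fin k ⊕ Unit) ℂ →ₗ[ℂ] X :=
    { toFun := fun S => ψ (S.submatrix Sum.inl Sum.inl) + S (Sum.inr ()) (Sum.inr ()) • (1 - ψ 1)
      map_add' := fun S T => by
        rw [Matrix.submatrix_add, Pi.add_apply, Pi.add_apply, map_add, Matrix.add_apply, add_smul]
        abel
      map_smul' := fun t S => by
        rw [RingHom.id_apply, Matrix.submatrix_smul, Pi.smul_apply, Pi.smul_apply, map_smul,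
          Matrix.smul_apply, smul_add, smul_assoc] }
  refine ⟨φ', ψ', ?_, ?_, ?_, ?_, fun x => ?_⟩
  · have h1 : IsFamilyCP fun T : Matrix (Fin k) (Fin k) ℂ =>
        (Matrix.fromBlocks T 0 0 0 : Matrix (Fin k ⊕ Unit) (Fin k ⊕ Unit) ℂ) := fun n c =>
      ⟨1, fun _ p => Matrix.fromBlocks (c p) 0 0 0, fun p q => by
        simp [Matrix.star_eq_conjTranspose, Matrix.fromBlocks_conjTranspose,
          Matrix.fromBlocks_multiply]⟩
    have h2 : IsFamilyCP fun x : X => (Matrix.fromBlocks 0 0 0 (Matrix.of fun _ _ => χ x) :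
        Matrix (Fin k ⊕ Unit) (Fin k ⊕ Unit) ℂ) := fun n c =>
      ⟨1, fun _ p => Matrix.fromBlocks 0 0 0 (Matrix.of fun _ _ => χ (c p)), fun p q => by
        simp only [Matrix.star_eq_conjTranspose, Matrix.fromBlocks_conjTranspose,
          Matrix.fromBlocks_multiply, Finset.univ_unique, Finset.sum_singleton, map_mul, map_star]
        congr 1
        · simp
        · simp
        · simp
        · ext
          simp [Matrix.mul_apply]⟩
    have h3 := (h1.comp (T := φ) (fun a b => by
      rw [Matrix.fromBlocks_add]; simp) hφ).add h2
    convert h3 using 2 with x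
    rw [Matrix.fromBlocks_add]
    simp [φ']
  · change Matrix.fromBlocks (φ 1) 0 0 (Matrix.of fun _ _ => χ 1) = 1
    rw [hφ1, map_one, ← Matrix.fromBlocks_one]
    congr 1
  · exact (hψ.comp (map_add ψ) (isFamilyCP_submatrix Sum.inl)).add
      (isFamilyCP_apply_smul (Sum.inr ()) (sub_nonneg.2 hψ1))
  · change ψ ((1 : Matrix (Fin k ⊕ Unit) (Fin k ⊕ Unit) ℂ).submatrix Sum.inl Sum.inl) +
      (1 : Matrix (Fin k ⊕ Unit) (Fin k ⊕ Unit) ℂ) (Sum.inr ()) (Sum.inr ()) • (1 - ψ 1) ≤ 1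
    rw [Matrix.submatrix_one _ Sum.inl_injective, Matrix.one_apply_eq, one_smul, add_sub_cancel]
  · rfl

lemma exists_unital_factorization (χ : X →⋆ₐ[ℂ] ℂ) {k : ℕ}
    {φ : X →ₗ[ℂ] Matrix (Fin k) (Fin k) ℂ} {ψ : Matrix (Fin k) (Fin k) ℂ →ₗ[ℂ] X}
    (hφ : IsFamilyCP φ) (hψ : IsFamilyCP ψ) (h1 : ‖ψ (φ 1)‖ ≤ 1) {δ c : ℝ} (hδ : 0 < δ)
    (hc : c = (1 + δ * ‖ψ 1‖)⁻¹) :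
    ∃ (φ' : X →ₗ[ℂ] Matrix (Fin k ⊕ Unit) (Fin k ⊕ Unit) ℂ)
      (ψ' : Matrix (Fin k ⊕ Unit) (Fin k ⊕ Unit) ℂ →ₗ[ℂ] X),
      IsFamilyCP φ' ∧ φ' 1 = 1 ∧ IsFamilyCP ψ' ∧ ψ' 1 ≤ 1 ∧
      ∀ x, ψ' (φ' x) = (c : ℂ) • ψ (φ x) + χ x • (1 - (c : ℂ) • ψ (φ 1)) := by
  have hc0 : 0 < c := by rw [hc]; positivity
  have hφ1 : (φ 1).PosSemidef := by
    obtain ⟨m, d, hd⟩ := hφ 1 ![1]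
    have h := hd 0 0
    simp only [Matrix.cons_val_zero, star_one, mul_one] at h
    rw [h]
    exact Matrix.posSemidef_sum _ fun r _ => Matrix.posSemidef_conjTranspose_mul_self _
  have hpos : (φ 1 + (δ : ℂ) • 1).PosDef :=
    Matrix.PosDef.posSemidef_add hφ1
      (Matrix.PosDef.smul Matrix.PosDef.one (by exact_mod_cast hδ))
  obtain ⟨t, s, ht, hs, hts, hst, htt⟩ := hpos.exists_sqrt
  let χ' : X →ₗ[ℂ] Matrix (Fin k) (Fin k) ℂ :=
    LinearMap.toSpanSingleton ℂ _ 1 ∘ₗ (χ : X →ₐ[ℂ] ℂ).toLinearMap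
  have hχ' : ∀ x, χ' x = χ x • 1 := fun x => rfl
  have hχcp : IsFamilyCP χ' := fun n d => ⟨1, fun _ p => χ (d p) • 1, fun p q => by
    simp [hχ', smul_smul, map_star, mul_comm]⟩
  let φδ := φ + (δ : ℂ) • χ'
  have hφδ : IsFamilyCP φδ := hφ.add (hχcp.smul hδ.le)
  have hφδ1 : φδ 1 = t * t := by
    rw [htt]
    change φ 1 + (δ : ℂ) • χ' 1 = _
    rw [hχ', map_one χ, one_smul]
  have hc1 := hφδ.conj s
  rw [hs] at hc1
  have hc2 : IsFamilyCP fun T : Matrix (Fin k) (Fin k) ℂ => t * T * t := by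
    have h : IsFamilyCP fun T : Matrix (Fin k) (Fin k) ℂ => T := fun n d =>
      ⟨1, fun _ => d, fun p q => by simp⟩
    have := h.conj t
    rwa [ht] at this
  let φ' : X →ₗ[ℂ] Matrix (Fin k) (Fin k) ℂ := LinearMap.mulLeftRight ℂ (s, s) ∘ₗ φδ
  let ψ' : Matrix (Fin k) (Fin k) ℂ →ₗ[ℂ] X :=
    (c : ℂ) • (ψ ∘ₗ LinearMap.mulLeftRight ℂ (t, t))
  have hψ' : ∀ T, ψ' T = (c : ℂ) • ψ (t * T * t) := fun T => rfl
  have hφ'1 : φ' 1 = 1 := by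
    change s * φδ 1 * s = 1
    rw [hφδ1, ← mul_assoc, hst, one_mul, hts]
  have hψ'1 : ψ' 1 = (c : ℂ) • (ψ (φ 1) + (δ : ℂ) • ψ 1) := by
    rw [hψ', mul_one, htt, map_add, map_smul]
  have hψ'cp : IsFamilyCP ψ' := (hψ.comp (map_add ψ) hc2).smul hc0.le
  have hψ'le : ψ' 1 ≤ 1 := by
    have h0 : 0 ≤ ψ' 1 := by
      have := hψ'cp.map_star_mul_self_nonneg 1
      rwa [star_one, mul_one] at this
    refine (CStarAlgebra.norm_le_one_iff_of_nonneg _ h0).1 ?_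
    rw [hψ'1, norm_smul, Complex.norm_real, Real.norm_of_nonneg hc0.le, hc,
      inv_mul_le_iff₀ (by positivity), mul_one]
    refine (norm_add_le _ _).trans (add_le_add h1 ?_)
    rw [norm_smul, Complex.norm_real, Real.norm_of_nonneg hδ.le]
  obtain ⟨φ₂, ψ₂, a1, a2, a3, a4, a5⟩ := exists_block_factorization χ (φ := φ') hc1 hφ'1 hψ'cp hψ'le
  refine ⟨φ₂, ψ₂, a1, a2, a3, a4, fun x => ?_⟩
  have e : t * φ' x * t = φδ x := by
    change t * (s * φδ x * s) * t = φδ x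
    calc _ = (t * s) * φδ x * (s * t) := by simp only [mul_assoc]
      _ = φδ x := by rw [hts, hst, one_mul, mul_one]
  have e2 : φδ x = φ x + (δ : ℂ) • χ x • 1 := rfl
  rw [a5, hψ'1, hψ', e, e2, map_add, map_smul, map_smul]
  module

lemma approxFactorable_of_character (χ : X →⋆ₐ[ℂ] ℂ)
    (h : ∀ (F : Finset X) (ε : ℝ), 0 < ε → ∃ (k : ℕ) (φ : X →ₗ[ℂ] Matrix (Fin k) (Fin k) ℂ)
      (ψ : Matrix (Fin k) (Fin k) ℂ →ₗ[ℂ] X), IsFamilyCP φ ∧ IsFamilyCP ψ ∧ ‖ψ (φ 1)‖ ≤ 1 ∧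
      ∀ x ∈ F, ‖ψ (φ x) + χ x • (1 - ψ (φ 1)) - x‖ < ε) : ApproxFactorable X := by
  intro F ε hε
  obtain ⟨k, φ, ψ, hφ, hψ, h1, hF⟩ := h F ε hε
  have htend : ∀ x, Tendsto (fun δ : ℝ => ‖(((1 + δ * ‖ψ 1‖)⁻¹ : ℝ) : ℂ) • ψ (φ x) +
      χ x • (1 - (((1 + δ * ‖ψ 1‖)⁻¹ : ℝ) : ℂ) • ψ (φ 1)) - x‖) (𝓝[>] 0)
      (𝓝 ‖ψ (φ x) + χ x • (1 - ψ (φ 1)) - x‖) := by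
    intro x
    have hc : ContinuousAt (fun δ : ℝ => ‖(((1 + δ * ‖ψ 1‖)⁻¹ : ℝ) : ℂ) • ψ (φ x) +
      χ x • (1 - (((1 + δ * ‖ψ 1‖)⁻¹ : ℝ) : ℂ) • ψ (φ 1)) - x‖) 0 := by
      have hi : ContinuousAt (fun δ : ℝ => (1 + δ * ‖ψ 1‖)⁻¹) 0 :=
        ContinuousAt.inv₀ (by fun_prop) (by simp)
      have hi' := Complex.continuous_ofReal.continuousAt.comp hi
      exact (((hi'.smul continuousAt_const).add (continuousAt_const.smul
        (continuousAt_const.sub (hi'.smul continuousAt_const)))).sub continuousAt_const).norm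
    have := hc.tendsto.mono_left (nhdsWithin_le_nhds (s := Set.Ioi 0))
    simpa using this
  have hev := (F.eventually_all).2 fun x hx => (htend x).eventually_lt_const (hF x hx)
  obtain ⟨δ, hδ, hδ0⟩ := (hev.and self_mem_nhdsWithin).exists
  obtain ⟨φ', ψ', a1, a2, a3, a4, a5⟩ := exists_unital_factorization χ hφ hψ h1 hδ0 rfl
  refine exists_faithful_factorization a1 a2 a3 a4 F fun x hx => ?_
  rw [a5]
  exact hδ x hx

end Factor

end

section

open scoped ComplexOrder
open Filter Topology

section Unitization

variable {A : Type*} [NonUnitalCStarAlgebra A]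

/-- An approximate unit compresses finitely many elements almost trivially. -/
lemma exists_norm_mul_mul_sub_lt (F : Finset A) {ε : ℝ} (hε : 0 < ε) :
    ∃ e : A, IsSelfAdjoint e ∧ ‖e‖ ≤ 1 ∧ ∀ a ∈ F, ‖e * a * e - a‖ < ε := by
  let _ : PartialOrder A := CStarAlgebra.spectralOrder A
  have _ : StarOrderedRing A := CStarAlgebra.spectralOrderedRing A
  have hun := CStarAlgebra.increasingApproximateUnit A
  have hev : ∀ᶠ e in CStarAlgebra.approximateUnit A, ∀ a ∈ F,
      ‖e * a - a‖ < ε / 2 ∧ ‖a * e - a‖ < ε / 2 := by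
    refine (F.eventually_all).2 fun a _ => ?_
    have h1 := Metric.tendsto_nhds.1 (hun.tendsto_mul_right a) (ε / 2) (half_pos hε)
    have h2 := Metric.tendsto_nhds.1 (hun.tendsto_mul_left a) (ε / 2) (half_pos hε)
    filter_upwards [h1, h2] with e h1 h2
    rw [dist_eq_norm] at h1 h2
    exact ⟨h1, h2⟩
  obtain ⟨e, he, h0, h1⟩ := (hev.and (hun.eventually_nonneg.and hun.eventually_norm)).exists
  refine ⟨e, h0.isSelfAdjoint, h1, fun a ha => ?_⟩
  have e1 : e * a * e - a = e * (a * e - a) + (e * a - a) := by noncomm_ring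
  rw [e1]
  refine (norm_add_le _ _).trans_lt ?_
  have := (norm_mul_le e (a * e - a)).trans (mul_le_of_le_one_left (norm_nonneg _) h1)
  linarith [(he a ha).1, (he a ha).2]

/-- The compression of the unitization to the original algebra by an element. -/
noncomputable def unitizationCompress (e : A) : Unitization ℂ A →ₗ[ℂ] A where
  toFun x := x.fst • (e * e) + e * x.snd * e
  map_add' x y := by
    simp only [Unitization.fst_add, Unitization.snd_add, add_smul, mul_add, add_mul]; abel
  map_smul' t x := by
    simp [smul_smul, mul_assoc, mul_smul_comm, smul_mul_assoc]

lemma unitizationCompress_apply (e : A) (x : Unitization ℂ A) :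
    unitizationCompress e x = x.fst • (e * e) + e * x.snd * e := rfl

lemma inr_unitizationCompress (e : A) (x : Unitization ℂ A) :
    (unitizationCompress e x : Unitization ℂ A) = (e : Unitization ℂ A) * x * e := by
  ext
  · simp [unitizationCompress_apply]
  · simp [unitizationCompress_apply, add_mul, smul_mul_assoc]

lemma isFamilyCP_unitizationCompress {e : A} (he : IsSelfAdjoint e) :
    IsFamilyCP (unitizationCompress e) := by
  have hin : ∀ x : Unitization ℂ A, ∃ a : A, x * (e : Unitization ℂ A) = a := fun x =>
    ⟨x.fst • e + x.snd * e, by ext <;> simp⟩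
  choose f hf using hin
  refine fun n c => ⟨1, fun _ p => f (c p), fun p q => ?_⟩
  apply Unitization.inr_injective (R := ℂ)
  rw [inr_unitizationCompress, Fin.sum_univ_one, Unitization.inr_mul, Unitization.inr_star, ← hf,
    ← hf, star_mul, ← Unitization.inr_star, he.star_eq]
  simp only [mul_assoc]

/-- The canonical character of the unitization. -/
noncomputable def unitizationCharacter (A : Type*) [NonUnitalCStarAlgebra A] :
    Unitization ℂ A →⋆ₐ[ℂ] ℂ :=
  { Unitization.fstHom ℂ A with map_star' := fun x => Unitization.fst_star x }

lemma IsNuclear.approxFactorable_unitization (hA : IsNuclear A)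
    [PartialOrder (Unitization ℂ A)] [StarOrderedRing (Unitization ℂ A)] :
    ApproxFactorable (Unitization ℂ A) := by
  refine approxFactorable_of_character (unitizationCharacter A) fun F ε hε => ?_
  classical
  obtain ⟨e, he, he1, hF⟩ := exists_norm_mul_mul_sub_lt
    (F.image fun x : Unitization ℂ A => x.snd) (half_pos hε)
  obtain ⟨k, φ, ψ, hφl, hψl, hφ, hψ, hc, hG⟩ :=
    hA ((F.image fun x : Unitization ℂ A => x.snd).image fun a => e * a * e) (ε / 2) (half_pos hε)
  let φL := hφl.mk' φ
  let ψL := hψl.mk' ψ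
  let iL : A →ₗ[ℂ] Unitization ℂ A := (Unitization.inrNonUnitalStarAlgHom ℂ A : A →ₗ[ℂ] Unitization ℂ A)
  have hi : ∀ a, iL a = a := fun _ => rfl
  have hφψ : ∀ x, (iL ∘ₗ ψL) ((φL ∘ₗ unitizationCompress e) x) =
      (ψ (φ (unitizationCompress e x)) : Unitization ℂ A) := fun _ => rfl
  have hc1 : unitizationCompress e 1 = e * e := by simp [unitizationCompress_apply]
  refine ⟨k, φL ∘ₗ unitizationCompress e, iL ∘ₗ ψL,
    (IsFamilyCP.of_isCompletelyPositive hφ).comp hφl.map_add (isFamilyCP_unitizationCompress he),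
    (IsFamilyCP.of_starHom (Unitization.inrNonUnitalStarAlgHom ℂ A)).comp (map_add _)
      (IsFamilyCP.of_isCompletelyPositive hψ), ?_, fun x hx => ?_⟩
  · rw [hφψ, Unitization.norm_inr, hc1]
    refine (hc _).trans ((norm_mul_le _ _).trans ?_)
    exact mul_le_one₀ he1 (norm_nonneg _) he1
  · rw [hφψ, hφψ, hc1]
    have e1 : (ψ (φ (unitizationCompress e x)) : Unitization ℂ A) +
        unitizationCharacter A x • (1 - (ψ (φ (e * e)) : Unitization ℂ A)) - x =
        ((ψ (φ (e * x.snd * e)) - e * x.snd * e + (e * x.snd * e - x.snd) : A) :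
          Unitization ℂ A) := by
      have e2 : ψ (φ (unitizationCompress e x)) =
          x.fst • ψ (φ (e * e)) + ψ (φ (e * x.snd * e)) := by
        rw [unitizationCompress_apply, hφl.map_add, hφl.map_smul, hψl.map_add, hψl.map_smul]
      have e3 : unitizationCharacter A x = x.fst := rfl
      have e4 : x.fst • (1 : Unitization ℂ A) + (x.snd : Unitization ℂ A) = x := by
        ext <;> simp
      rw [e2, e3, sub_eq_iff_eq_add]
      simp only [Unitization.inr_add, Unitization.inr_sub, Unitization.inr_smul]
      refine Eq.trans ?_ (congrArg (_ + ·) e4)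
      module
    rw [e1, Unitization.norm_inr]
    have hx' := Finset.mem_image_of_mem (fun x : Unitization ℂ A => x.snd) hx
    refine (norm_add_le _ _).trans_lt ?_
    linarith [hF _ hx', hG _ (Finset.mem_image_of_mem (fun a => e * a * e) hx')]

end Unitization

end

section

open scoped ComplexOrder
open Filter Topology

section Descent

variable {A B : Type*} [NonUnitalCStarAlgebra A] [NonUnitalCStarAlgebra B]

/-- A point-norm limit of additive completely positive families. -/
def IsApproxCP {X Y : Type*} [NonUnitalRing X] [StarRing X] [NonUnitalCStarAlgebra Y]
    (θ : X → Y) : Prop :=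
  ∀ (F : Finset X) (ε : ℝ), 0 < ε → ∃ T : X → Y, IsFamilyCP T ∧ (∀ a b, T (a + b) = T a + T b) ∧
    ∀ x ∈ F, ‖T x - θ x‖ < ε

lemma IsApproxCP.isCompletelyPositive {X Y : Type*} [NonUnitalRing X] [StarRing X]
    [NonUnitalCStarAlgebra Y] {θ : X → Y} (hθ : IsApproxCP θ) : IsCompletelyPositive θ := by
  choose T hT hadd hlim using fun i : Finset X × ℕ => hθ i.1 (1 / ((i.2 : ℝ) + 1)) (by positivity)
  classical
  refine isCompletelyPositive_of_tendsto (l := atTop) hT hadd fun x => ?_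
  rw [Metric.tendsto_nhds]
  intro ε hε
  obtain ⟨n, hn⟩ := exists_nat_one_div_lt hε
  filter_upwards [eventually_ge_atTop (({x} : Finset X), n)] with i hi
  rw [dist_eq_norm]
  refine (hlim i x (hi.1 (Finset.mem_singleton_self x))).trans (lt_of_le_of_lt ?_ hn)
  have : (n : ℝ) ≤ i.2 := by exact_mod_cast hi.2
  gcongr

lemma separableSpace_unitization [TopologicalSpace.SeparableSpace A] :
    TopologicalSpace.SeparableSpace (Unitization ℂ A) := by
  have hc : Continuous fun p : ℂ × A => p.1 • (1 : Unitization ℂ A) + (p.2 : Unitization ℂ A) :=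
    (continuous_fst.smul continuous_const).add
      ((Unitization.isometry_inr (𝕜 := ℂ) (A := A)).continuous.comp continuous_snd)
  refine (Function.Surjective.denseRange (f := fun p : ℂ × A =>
    p.1 • (1 : Unitization ℂ A) + (p.2 : Unitization ℂ A)) fun x => ⟨(x.fst, x.snd), ?_⟩).separableSpace
      hc
  ext <;> simp

/-- The Choi–Effros lifting theorem for separable nuclear C⋆-algebras. -/
theorem IsNuclear.exists_section [TopologicalSpace.SeparableSpace A] (hA : IsNuclear A) {π : A →⋆ₙₐ[ℂ] B}
    (hπ : Function.Surjective π) :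
    ∃ θ : B →ₗ[ℂ] A, IsApproxCP θ ∧ (∀ b, ‖θ b‖ ≤ ‖b‖) ∧ ∀ b, π (θ b) = b := by
  let _ : PartialOrder (Unitization ℂ A) := CStarAlgebra.spectralOrder _
  have _ : StarOrderedRing (Unitization ℂ A) := CStarAlgebra.spectralOrderedRing _
  let _ : PartialOrder (Unitization ℂ B) := CStarAlgebra.spectralOrder _
  have _ : StarOrderedRing (Unitization ℂ B) := CStarAlgebra.spectralOrderedRing _
  have _ := separableSpace_unitization (A := A)
  obtain ⟨Θ, S, hS, hlim, hn, hs⟩ := exists_section_of_approxFactorable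
    hA.approxFactorable_unitization (π := Unitization.starMap π) (Unitization.starMap_surjective hπ)
  let iB : B →ₗ[ℂ] Unitization ℂ B :=
    (Unitization.inrNonUnitalStarAlgHom ℂ B : B →ₗ[ℂ] Unitization ℂ B)
  have hi : ∀ b, iB b = b := fun _ => rfl
  let θ : B →ₗ[ℂ] A := Unitization.sndHom ℂ ℂ A ∘ₗ Θ ∘ₗ iB
  have hθ : ∀ b : B, (θ b : Unitization ℂ A) = Θ b := by
    intro b
    have h0 : (Unitization.starMap π (Θ b)).fst = 0 := by rw [hs, Unitization.fst_inr]
    ext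
    · rw [Unitization.fst_inr, ← h0]
      simp [Unitization.algebraMap_eq_inl]
    · rfl
  refine ⟨θ, fun F ε hε => ?_, fun b => ?_, fun b => ?_⟩
  · classical
    obtain ⟨e, he, he1, hF⟩ := exists_norm_mul_mul_sub_lt (F.image θ) (half_pos hε)
    have hev : ∀ᶠ n in atTop, ∀ b ∈ F, ‖S n b - Θ b‖ < ε / 2 := by
      refine (F.eventually_all).2 fun b _ => ?_
      filter_upwards [Metric.tendsto_nhds.1 (hlim b) (ε / 2) (half_pos hε)] with n h
      rwa [dist_eq_norm] at h
    obtain ⟨n, hn⟩ := hev.exists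
    refine ⟨unitizationCompress e ∘ₗ S n ∘ₗ iB, ?_, map_add _, fun b hb => ?_⟩
    · exact (isFamilyCP_unitizationCompress he).comp (map_add _) ((hS n).1.comp (map_add _)
        (IsFamilyCP.of_starHom (Unitization.inrNonUnitalStarAlgHom ℂ B)))
    · have e1 : (unitizationCompress e ∘ₗ S n ∘ₗ iB) b - θ b =
          unitizationCompress e (S n b - Θ b) + (e * θ b * e - θ b) := by
        apply Unitization.inr_injective (R := ℂ)
        simp only [Unitization.inr_add, Unitization.inr_sub, Unitization.inr_mul, hθ,
          LinearMap.comp_apply, inr_unitizationCompress, hi]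
        noncomm_ring
      rw [e1]
      refine (norm_add_le _ _).trans_lt ?_
      have e2 : ‖unitizationCompress e (S n b - Θ b)‖ ≤ ‖S n b - Θ b‖ := by
        rw [← Unitization.norm_inr (𝕜 := ℂ), inr_unitizationCompress]
        have he1' : ‖(e : Unitization ℂ A)‖ ≤ 1 := by rwa [Unitization.norm_inr]
        calc _ ≤ ‖(e : Unitization ℂ A)‖ * ‖S n b - Θ b‖ * ‖(e : Unitization ℂ A)‖ := norm_mul₃_le
          _ ≤ 1 * ‖S n b - Θ b‖ * 1 := by gcongr
          _ = _ := by ring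
      linarith [hF _ (Finset.mem_image_of_mem θ hb), hn b hb]
  · rw [← Unitization.norm_inr (𝕜 := ℂ), hθ, ← Unitization.norm_inr (𝕜 := ℂ) (a := b)]
    exact hn _
  · apply Unitization.inr_injective (R := ℂ)
    rw [← hs b, ← hθ, Unitization.starMap_inr]

end Descent

end

section

open scoped ComplexOrder
open Filter Topology

section Averaging

variable {A B : Type*} [NonUnitalCStarAlgebra A] [NonUnitalCStarAlgebra B]

lemma StarAlgEquiv.norm_apply_eq (e : A ≃⋆ₐ[ℂ] A) (x : A) : ‖e x‖ = ‖x‖ := by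
  refine le_antisymm (NonUnitalStarAlgHom.norm_apply_le e x) ?_
  have := NonUnitalStarAlgHom.norm_apply_le e.symm (e x)
  rwa [e.symm_apply_apply] at this

variable {G : Type*} [Group G] {α : G → A ≃⋆ₐ[ℂ] A} {β : G → B ≃⋆ₐ[ℂ] B}

/-- The sum over `K` of the conjugates of `θ` by a pair of actions. -/
noncomputable def conjSum (α : G → A ≃⋆ₐ[ℂ] A) (β : G → B ≃⋆ₐ[ℂ] B) (θ : B →ₗ[ℂ] A)
    (K : Finset G) : B →ₗ[ℂ] A where
  toFun b := ∑ s ∈ K, α s (θ (β s⁻¹ b))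
  map_add' x y := by simp [Finset.sum_add_distrib]
  map_smul' t x := by simp [Finset.smul_sum]

lemma conjSum_apply (θ : B →ₗ[ℂ] A) (K : Finset G) (b : B) :
    conjSum α β θ K b = ∑ s ∈ K, α s (θ (β s⁻¹ b)) := rfl

lemma norm_conj_le {θ : B →ₗ[ℂ] A} (hθ : ∀ b, ‖θ b‖ ≤ ‖b‖) (s : G) (b : B) :
    ‖α s (θ (β s⁻¹ b))‖ ≤ ‖b‖ := by
  rw [StarAlgEquiv.norm_apply_eq, ← StarAlgEquiv.norm_apply_eq (β s⁻¹) b]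
  exact hθ _

lemma norm_conjSum_le {θ : B →ₗ[ℂ] A} (hθ : ∀ b, ‖θ b‖ ≤ ‖b‖) (K : Finset G) (b : B) :
    ‖conjSum α β θ K b‖ ≤ K.card * ‖b‖ := by
  rw [conjSum_apply, ← nsmul_eq_mul]
  exact norm_sum_le_of_le _ (fun s _ => norm_conj_le hθ s b) |>.trans_eq (by simp)

lemma apply_conjSum (hα : ∀ g h x, α (g * h) x = α g (α h x))
    (hβ : ∀ g h x, β (g * h) x = β g (β h x)) [DecidableEq G] (θ : B →ₗ[ℂ] A) (K : Finset G)
    (t : G) (b : B) : α t (conjSum α β θ K b) = conjSum α β θ (K.image (t * ·)) (β t b) := by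
  rw [conjSum_apply, conjSum_apply, map_sum, Finset.sum_image fun x _ y _ h => mul_left_cancel h]
  refine Finset.sum_congr rfl fun s _ => ?_
  rw [hα, ← hβ, mul_inv_rev, inv_mul_cancel_right]

lemma norm_conjSum_sub_le [DecidableEq G] {θ : B →ₗ[ℂ] A} (hθ : ∀ b, ‖θ b‖ ≤ ‖b‖)
    (K L : Finset G) (b : B) :
    ‖conjSum α β θ K b - conjSum α β θ L b‖ ≤ (K ∆ L).card * ‖b‖ := by
  have h1 : conjSum α β θ K b - conjSum α β θ L b =
      conjSum α β θ (K \ L) b - conjSum α β θ (L \ K) b := by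
    simp only [conjSum_apply]
    exact (Finset.sum_sdiff_sub_sum_sdiff).symm
  have h2 : (K ∆ L).card = (K \ L).card + (L \ K).card := by
    rw [symmDiff_def, Finset.sup_eq_union, Finset.card_union_of_disjoint disjoint_sdiff_sdiff]
  rw [h1, h2, Nat.cast_add, add_mul]
  exact (norm_sub_le _ _).trans (add_le_add (norm_conjSum_le hθ _ b) (norm_conjSum_le hθ _ b))

lemma isApproxCP_smul_conjSum {θ : B →ₗ[ℂ] A} (hθ : IsApproxCP θ) (K : Finset G) {r : ℝ}
    (hr : 0 ≤ r) : IsApproxCP ((r : ℂ) • conjSum α β θ K) := by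
  classical
  intro F ε hε
  set δ := ε / (1 + r * K.card) with hδ
  have hpos : 0 < 1 + r * K.card := by positivity
  obtain ⟨T, hT, hadd, hF⟩ := hθ ((K ×ˢ F).image fun p => β p.1⁻¹ p.2) δ (div_pos hε hpos)
  refine ⟨fun b => (r : ℂ) • ∑ s ∈ K, α s (T (β s⁻¹ b)), ?_, fun a b => ?_, fun b hb => ?_⟩
  · refine IsFamilyCP.smul (IsFamilyCP.sum K fun s _ => ?_) hr
    exact (IsFamilyCP.of_starHom (α s : A →⋆ₙₐ[ℂ] A)).comp (map_add (α s))
      (hT.comp hadd (IsFamilyCP.of_starHom (β s⁻¹ : B →⋆ₙₐ[ℂ] B)))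
  · simp [hadd, Finset.sum_add_distrib]
  · rw [LinearMap.smul_apply, conjSum_apply, ← smul_sub, ← Finset.sum_sub_distrib, norm_smul,
      Complex.norm_real, Real.norm_of_nonneg hr]
    have h1 : ‖∑ s ∈ K, (α s (T (β s⁻¹ b)) - α s (θ (β s⁻¹ b)))‖ ≤ K.card * δ := by
      rw [← nsmul_eq_mul]
      refine (norm_sum_le_of_le _ fun s hs => ?_).trans_eq (Finset.sum_const δ)
      rw [← map_sub, StarAlgEquiv.norm_apply_eq]
      exact (hF _ (Finset.mem_image_of_mem _ (Finset.mk_mem_product hs hb))).le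
    calc r * _ ≤ r * (K.card * δ) := by gcongr
      _ < ε := by
        rw [hδ, ← mul_assoc, mul_div_assoc', div_lt_iff₀ hpos]
        nlinarith

end Averaging

end

/-- Let `G` be a discrete amenable group, `A` a separable nuclear C*-algebra with
`G`-action `α`, `B` a C*-algebra with `G`-action `β`, and `π : A → B` a surjective
equivariant *-homomorphism. Then for any finite `F ⊆ B`, finite `M ⊆ G` and `ε > 0`
there is a contractive completely positive section `θ : B → A` of `π` which is
approximately equivariant on `F` and `M`. -/
theorem exists_almost_equivariant_ccp_section
    (G : Type*) [Group G] [DecidableEq G] (hamen : FolnerCondition G)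
    (A : Type*) [NonUnitalCStarAlgebra A]
    [TopologicalSpace.SeparableSpace A] (hnuc : IsNuclear A)
    (B : Type*) [NonUnitalCStarAlgebra B]
    (α : G → A ≃⋆ₐ[ℂ] A) (hα : ∀ g h x, α (g * h) x = α g (α h x))
    (β : G → B ≃⋆ₐ[ℂ] B) (hβ : ∀ g h x, β (g * h) x = β g (β h x))
    (π : A →⋆ₙₐ[ℂ] B) (hsurj : Function.Surjective π)
    (hequiv : ∀ (g : G) (x : A), π (α g x) = β g (π x))
    (F : Finset B) (M : Finset G) (ε : ℝ) (hε : 0 < ε) :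
    ∃ θ : B → A, IsLinearMap ℂ θ ∧ IsCompletelyPositive θ ∧
      (∀ b : B, ‖θ b‖ ≤ ‖b‖) ∧ (∀ b : B, π (θ b) = b) ∧
      ∀ b ∈ F, ∀ t ∈ M, ‖α t (θ b) - θ (β t b)‖ < ε := by
  obtain ⟨θ, hcp, hn, hs⟩ := hnuc.exists_section hsurj
  set C : ℝ := 1 + ∑ b ∈ F, ‖b‖ with hC
  have hC0 : 0 < C := by positivity
  obtain ⟨K, hK, hKM⟩ := hamen M (ε / C) (div_pos hε hC0)
  have hK0 : (0 : ℝ) < K.card := by exact_mod_cast hK.card_pos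
  have hKc : (K.card : ℂ) ≠ 0 := by exact_mod_cast hK.card_pos.ne'
  have hr : (0 : ℝ) ≤ (K.card : ℝ)⁻¹ := by positivity
  have hsm : ∀ x : A, ‖(((K.card : ℝ)⁻¹ : ℝ) : ℂ) • x‖ = (K.card : ℝ)⁻¹ * ‖x‖ := fun x => by
    rw [norm_smul, Complex.norm_real, Real.norm_of_nonneg hr]
  have hβ1 : ∀ x, β 1 x = x := fun x => EquivLike.injective (β 1) (by rw [← hβ, one_mul])
  refine ⟨((((K.card : ℝ)⁻¹ : ℝ) : ℂ) • conjSum α β θ K : B →ₗ[ℂ] A), LinearMap.isLinear _,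
    (isApproxCP_smul_conjSum hcp K hr).isCompletelyPositive, fun b => ?_, fun b => ?_,
    fun b hb t ht => ?_⟩
  · rw [LinearMap.smul_apply, hsm, inv_mul_le_iff₀ hK0]
    exact norm_conjSum_le hn K b
  · have h : ∀ s ∈ K, π (α s (θ (β s⁻¹ b))) = b := fun s _ => by
      rw [hequiv, hs, ← hβ, mul_inv_cancel, hβ1]
    rw [LinearMap.smul_apply, map_smul, conjSum_apply, map_sum, Finset.sum_congr rfl h,
      Finset.sum_const, ← Nat.cast_smul_eq_nsmul ℂ, smul_smul]
    push_cast
    rw [inv_mul_cancel₀ hKc, one_smul]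
  · rw [LinearMap.smul_apply, LinearMap.smul_apply, map_smul, ← smul_sub, hsm,
      apply_conjSum hα hβ, inv_mul_lt_iff₀ hK0]
    refine (norm_conjSum_sub_le hn _ _ _).trans_lt ?_
    rw [StarAlgEquiv.norm_apply_eq]
    have hb' : ‖b‖ < C := by
      have := Finset.single_le_sum (f := fun b : B => ‖b‖) (fun _ _ => norm_nonneg _) hb
      linarith
    calc _ ≤ ε / C * K.card * ‖b‖ := by gcongr; exact hKM t ht
      _ < ε / C * K.card * C := by gcongr
      _ = K.card * ε := by field_simp
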